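/- arXiv:1502.00693 — 2 statements merged into one kernel-verified Lean document; each statement's English description precedes it below -/
import Mathlib

section
/- A heptagonal typical 7-configuration has at most one point of dominance index 6 and at most one point of dominance index 0. -/
open scoped LinearAlgebra.Projectivization
open Projectivization

noncomputable section

/-- The real projective plane: the projectivization of `ℝ³`. -/
abbrev RP2 := ℙ ℝ (Fin 3 → ℝ)

/-- The quotient topology on the real projective plane. -/
instance : TopologicalSpace RP2 :=
  inferInstanceAs (TopologicalSpace (Quotient (projectivizationSetoid ℝ (Fin 3 → ℝ))))

/-- Three points of `ℙ²(ℝ)` are collinear if they admit linearly dependent representatives. -/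
def Collin (a b c : RP2) : Prop :=
  ¬ LinearIndependent ℝ ![a.rep, b.rep, c.rep]

/-- The conic (zero set in `ℙ²(ℝ)`) associated to a quadratic form on `ℝ³`. -/
def ConicSet (q : QuadraticForm ℝ (Fin 3 → ℝ)) : Set RP2 := {p : RP2 | q p.rep = 0}

/-- A set of points is coconic if some conic contains all of them. -/
def Coconic (s : Set RP2) : Prop :=
  ∃ q : QuadraticForm ℝ (Fin 3 → ℝ), q ≠ 0 ∧ ∀ p ∈ s, q p.rep = 0

/-- A labeled `n`-configuration is simple if it is injective and has no collinear triple. -/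
def SimpleCfg {n : ℕ} (f : Fin n → RP2) : Prop :=
  Function.Injective f ∧
    ∀ i j k : Fin n, i ≠ j → i ≠ k → j ≠ k → ¬ Collin (f i) (f j) (f k)

/-- A labeled `n`-configuration is typical if it is simple and no six of its points are coconic. -/
def TypicalCfg {n : ℕ} (f : Fin n → RP2) : Prop :=
  SimpleCfg f ∧ ∀ g : Fin 6 → Fin n, Function.Injective g → ¬ Coconic (Set.range (f ∘ g))

/-- A projective line: the set of points whose representatives lie in a 2-dimensional
subspace of `ℝ³`. -/
def IsProjLine (L : Set RP2) : Prop :=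
  ∃ W : Submodule ℝ (Fin 3 → ℝ), Module.finrank ℝ W = 2 ∧ L = {p : RP2 | p.rep ∈ W}

/-- `p` lies inside the conic of `q` if every projective line through `p` meets the conic. -/
def InsideConic (q : QuadraticForm ℝ (Fin 3 → ℝ)) (p : RP2) : Prop :=
  ∀ L : Set RP2, IsProjLine L → p ∈ L → (L ∩ ConicSet q).Nonempty

/-- `p` lies outside the conic of `q` if some projective line through `p` misses the conic. -/
def OutsideConic (q : QuadraticForm ℝ (Fin 3 → ℝ)) (p : RP2) : Prop :=
  ∃ L : Set RP2, IsProjLine L ∧ p ∈ L ∧ L ∩ ConicSet q = ∅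

/-- A point `f i` of a configuration is dominant if it lies outside every conic passing
through all the other points of the configuration. -/
def Dominant {n : ℕ} (f : Fin n → RP2) (i : Fin n) : Prop :=
  ∀ q : QuadraticForm ℝ (Fin 3 → ℝ), q ≠ 0 → (∀ j, j ≠ i → q ((f j).rep) = 0) →
    OutsideConic q (f i)

/-- A point `f i` of a configuration is subdominant if it lies inside every conic passing
through all the other points of the configuration. -/
def Subdominant {n : ℕ} (f : Fin n → RP2) (i : Fin n) : Prop :=
  ∀ q : QuadraticForm ℝ (Fin 3 → ℝ), q ≠ 0 → (∀ j, j ≠ i → q ((f j).rep) = 0) →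
    InsideConic q (f i)

/-- The affine chart determined by a nonzero linear functional `φ` (with `L∞ = {φ = 0}`):
a point off `L∞` is sent to its representative rescaled to lie on the affine plane `φ = 1`. -/
def chart (φ : (Fin 3 → ℝ) →ₗ[ℝ] ℝ) (p : RP2) : Fin 3 → ℝ := (φ p.rep)⁻¹ • p.rep

/-- Convex position with respect to the affine chart of `φ`: the line `{φ = 0}` misses the
configuration, and in the chart every point lies outside the convex hull of the others. -/
def ConvexPosWith {n : ℕ} (φ : (Fin 3 → ℝ) →ₗ[ℝ] ℝ) (f : Fin n → RP2) : Prop :=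
  φ ≠ 0 ∧ (∀ i, φ (f i).rep ≠ 0) ∧
    ∀ i, chart φ (f i) ∉ convexHull ℝ (chart φ '' (f '' {j | j ≠ i}))

/-- A configuration is in convex position if it is so in some affine chart. -/
def ConvexPos {n : ℕ} (f : Fin n → RP2) : Prop := ∃ φ, ConvexPosWith φ f

/-- The labeling of a configuration is consecutive for the convex position in the chart of `φ`:
each pair `f i`, `f (i+1)` (cyclically) spans an edge of the convex polygon, i.e. is cut out by
an affine functional which is strictly larger on both of them than on all the other points. -/
def ConsecWith {n : ℕ} [NeZero n] (φ : (Fin 3 → ℝ) →ₗ[ℝ] ℝ) (f : Fin n → RP2) : Prop :=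
  ConvexPosWith φ f ∧
    ∀ i : Fin n, ∃ ψ : (Fin 3 → ℝ) →ₗ[ℝ] ℝ,
      ψ (chart φ (f i)) = ψ (chart φ (f (i + 1))) ∧
      ∀ j : Fin n, j ≠ i → j ≠ i + 1 → ψ (chart φ (f j)) < ψ (chart φ (f i))

/-- A configuration is in convex position with consecutive cyclic labeling. -/
def ConsecConvexPos {n : ℕ} [NeZero n] (f : Fin n → RP2) : Prop := ∃ φ, ConsecWith φ f

/-- A Q-deformation (an `n`-tuple of continuous paths through typical configurations). -/
def QDeformFam (n : ℕ) (γ : Fin n → unitInterval → RP2) : Prop :=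
  (∀ i, Continuous (γ i)) ∧ ∀ t : unitInterval, TypicalCfg (fun i => γ i t)

end
noncomputable section

/-- `f i` lies outside every conic through the five points of the 7-configuration other
than `f i` and `f j`. -/
def OutAll (f : Fin 7 → RP2) (i j : Fin 7) : Prop :=
  ∀ q : QuadraticForm ℝ (Fin 3 → ℝ), q ≠ 0 → (∀ k, k ≠ i → k ≠ j → q ((f k).rep) = 0) →
    OutsideConic q (f i)

open Classical in
/-- `d_{i,j}` equals 1 if `f i` lies outside every conic through the five remaining points,
and 0 otherwise (i.e. if it lies inside every such conic). -/
def dIdx (f : Fin 7 → RP2) (i j : Fin 7) : ℕ :=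
  if OutAll f i j then 1 else 0

/-- The dominance index `d(p_i) = Σ_{j ≠ i} d_{i,j}`. -/
def domIdx (f : Fin 7 → RP2) (i : Fin 7) : ℕ :=
  ∑ j ∈ Finset.univ.erase i, dIdx f i j
/-- The determinant of three vectors of `ℝ³`. -/
def det3 (x y z : Fin 3 → ℝ) : ℝ :=
  x 0 * (y 1 * z 2 - y 2 * z 1) - x 1 * (y 0 * z 2 - y 2 * z 0) + x 2 * (y 0 * z 1 - y 1 * z 0)

lemma det3_comb (a b c : Fin 3 → ℝ) (x₁ x₂ x₃ y₁ y₂ y₃ z₁ z₂ z₃ : ℝ) :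
    det3 (x₁ • a + x₂ • b + x₃ • c) (y₁ • a + y₂ • b + y₃ • c) (z₁ • a + z₂ • b + z₃ • c) =
      det3 a b c * (x₁ * (y₂ * z₃ - y₃ * z₂) - x₂ * (y₁ * z₃ - y₃ * z₁)
        + x₃ * (y₁ * z₂ - y₂ * z₁)) := by
  simp only [det3, Pi.add_apply, Pi.smul_apply, smul_eq_mul]
  ring

section Coordinates

variable (a b c : Fin 3 → ℝ) (x₁ x₂ x₃ y₁ y₂ y₃ : ℝ)

lemma det3_coord₁ : det3 (x₁ • a + x₂ • b + x₃ • c) b c = det3 a b c * x₁ := by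
  simpa using det3_comb a b c x₁ x₂ x₃ 0 1 0 0 0 1

lemma det3_coord₂ : det3 (x₁ • a + x₂ • b + x₃ • c) c a = det3 a b c * x₂ := by
  simpa using det3_comb a b c x₁ x₂ x₃ 0 0 1 1 0 0

lemma det3_coord_swap₂ : det3 (x₁ • a + x₂ • b + x₃ • c) a c = det3 a b c * -x₂ := by
  simpa using det3_comb a b c x₁ x₂ x₃ 1 0 0 0 0 1

lemma det3_coord₃ : det3 (x₁ • a + x₂ • b + x₃ • c) a b = det3 a b c * x₃ := by
  simpa using det3_comb a b c x₁ x₂ x₃ 1 0 0 0 1 0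

lemma det3_coord_left :
    det3 (x₁ • a + x₂ • b + x₃ • c) a (y₁ • a + y₂ • b + y₃ • c) =
      det3 a b c * (y₂ * x₃ - y₃ * x₂) := by
  have := det3_comb a b c x₁ x₂ x₃ 1 0 0 y₁ y₂ y₃
  simp only [one_smul, zero_smul, add_zero] at this
  rw [this]
  ring

lemma det3_coord_middle :
    det3 (x₁ • a + x₂ • b + x₃ • c) b (y₁ • a + y₂ • b + y₃ • c) =
      det3 a b c * (y₃ * x₁ - y₁ * x₃) := by
  have := det3_comb a b c x₁ x₂ x₃ 0 1 0 y₁ y₂ y₃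
  simp only [one_smul, zero_smul, add_zero, zero_add] at this
  rw [this]
  ring

lemma det3_coord_right :
    det3 (x₁ • a + x₂ • b + x₃ • c) c (y₁ • a + y₂ • b + y₃ • c) =
      det3 a b c * (y₁ * x₂ - y₂ * x₁) := by
  have := det3_comb a b c x₁ x₂ x₃ 0 0 1 y₁ y₂ y₃
  simp only [one_smul, zero_smul, zero_add] at this
  rw [this]
  ring

end Coordinates

lemma exists_coord {a b c : Fin 3 → ℝ} (h : det3 a b c ≠ 0) (x : Fin 3 → ℝ) :
    ∃ x₁ x₂ x₃ : ℝ, x = x₁ • a + x₂ • b + x₃ • c := by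
  refine ⟨det3 x b c / det3 a b c, det3 x c a / det3 a b c, det3 x a b / det3 a b c, ?_⟩
  have key : ∀ n, x n * det3 a b c = det3 x b c * a n + det3 x c a * b n + det3 x a b * c n := by
    intro n
    fin_cases n <;> simp only [det3] <;> simp <;> ring
  ext n
  simp only [Pi.add_apply, Pi.smul_apply, smul_eq_mul]
  field_simp
  linear_combination key n

lemma comb_eq_zero {a b c : Fin 3 → ℝ} (h : det3 a b c ≠ 0) {x y z : ℝ}
    (hx : x • a + y • b + z • c = 0) : x = 0 ∧ y = 0 ∧ z = 0 := by
  have h0 := congrFun hx 0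
  have h1 := congrFun hx 1
  have h2 := congrFun hx 2
  simp only [Pi.add_apply, Pi.smul_apply, smul_eq_mul, Pi.zero_apply] at h0 h1 h2
  refine ⟨?_, ?_, ?_⟩ <;> refine (mul_eq_zero.mp ?_).resolve_right h <;> unfold det3
  · linear_combination h0 * (b 1 * c 2 - b 2 * c 1) - h1 * (b 0 * c 2 - b 2 * c 0)
      + h2 * (b 0 * c 1 - b 1 * c 0)
  · linear_combination h0 * (c 1 * a 2 - c 2 * a 1) - h1 * (c 0 * a 2 - c 2 * a 0)
      + h2 * (c 0 * a 1 - c 1 * a 0)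
  · linear_combination h0 * (a 1 * b 2 - a 2 * b 1) - h1 * (a 0 * b 2 - a 2 * b 0)
      + h2 * (a 0 * b 1 - a 1 * b 0)

/-- The linear functional `x ↦ det (x, y, z)`. -/
def det3Lin (y z : Fin 3 → ℝ) : (Fin 3 → ℝ) →ₗ[ℝ] ℝ where
  toFun x := det3 x y z
  map_add' x x' := by simp only [det3, Pi.add_apply]; ring
  map_smul' k x := by simp only [det3, Pi.smul_apply, smul_eq_mul, RingHom.id_apply]; ring

lemma exists_quadraticForm {a b c : Fin 3 → ℝ} (h : det3 a b c ≠ 0) (r s t : ℝ) :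
    ∃ q : QuadraticForm ℝ (Fin 3 → ℝ), ∀ x y z : ℝ,
      q (x • a + y • b + z • c) = r * y * z + s * x * z + t * x * y := by
  refine ⟨(r / det3 a b c ^ 2) • QuadraticMap.linMulLin (det3Lin c a) (det3Lin a b)
    + (s / det3 a b c ^ 2) • QuadraticMap.linMulLin (det3Lin b c) (det3Lin a b)
    + (t / det3 a b c ^ 2) • QuadraticMap.linMulLin (det3Lin b c) (det3Lin c a), ?_⟩
  intro x y z
  have h1 : det3Lin b c (x • a + y • b + z • c) = x * det3 a b c := by
    simp only [det3Lin, LinearMap.coe_mk, AddHom.coe_mk, det3, Pi.add_apply, Pi.smul_apply,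
      smul_eq_mul]
    ring
  have h2 : det3Lin c a (x • a + y • b + z • c) = y * det3 a b c := by
    simp only [det3Lin, LinearMap.coe_mk, AddHom.coe_mk, det3, Pi.add_apply, Pi.smul_apply,
      smul_eq_mul]
    ring
  have h3 : det3Lin a b (x • a + y • b + z • c) = z * det3 a b c := by
    simp only [det3Lin, LinearMap.coe_mk, AddHom.coe_mk, det3, Pi.add_apply, Pi.smul_apply,
      smul_eq_mul]
    ring
  simp only [add_apply, smul_apply, QuadraticMap.linMulLin_apply,
    h1, h2, h3, smul_eq_mul]
  field_simp

lemma quadraticForm_formula (q : QuadraticForm ℝ (Fin 3 → ℝ)) {a b c : Fin 3 → ℝ}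
    (ha : q a = 0) (hb : q b = 0) (hc : q c = 0) :
    ∃ r s t : ℝ, ∀ x y z : ℝ,
      q (x • a + y • b + z • c) = r * y * z + s * x * z + t * x * y := by
  refine ⟨QuadraticMap.polar q b c, QuadraticMap.polar q a c, QuadraticMap.polar q a b, ?_⟩
  intro x y z
  simp only [QuadraticMap.map_add q, QuadraticMap.map_smul, QuadraticMap.polar_add_left,
    QuadraticMap.polar_smul_left, QuadraticMap.polar_smul_right, ha, hb, hc, smul_eq_mul]
  ring

/-- An indefinite binary quadratic form takes a positive value. -/
lemma exists_binary_pos {α β γ : ℝ} (h : α * γ < β ^ 2) (hα : α ≤ 0) :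
    ∃ x y : ℝ, 0 < α * x ^ 2 + 2 * β * x * y + γ * y ^ 2 := by
  rcases hα.lt_or_eq with hα | rfl
  · refine ⟨-β, α, ?_⟩
    have : α * (-β) ^ 2 + 2 * β * (-β) * α + γ * α ^ 2 = (-α) * (β ^ 2 - α * γ) := by ring
    rw [this]
    exact mul_pos (by linarith) (by linarith)
  · have hβ : β ≠ 0 := by rintro rfl; simp at h
    refine ⟨(1 - γ) / (2 * β), 1, ?_⟩
    have : (0 : ℝ) * ((1 - γ) / (2 * β)) ^ 2 + 2 * β * ((1 - γ) / (2 * β)) * 1 + γ * 1 ^ 2 = 1 := by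
      field_simp
      ring
    rw [this]
    exact one_pos

section Conic

variable {q : QuadraticForm ℝ (Fin 3 → ℝ)} {a b c : Fin 3 → ℝ} {r s t w₁ w₂ w₃ k : ℝ} {P : RP2}

lemma outsideConic_of_neg
    (hq : ∀ x y z : ℝ, q (x • a + y • b + z • c) = r * y * z + s * x * z + t * x * y)
    (hk : k ≠ 0) (hP : w₁ • a + w₂ • b + w₃ • c = k • P.rep) (hw : w₃ ≠ 0)
    (hneg : (r * w₂ * w₃ + s * w₁ * w₃ + t * w₁ * w₂) * (r * s * t) < 0) :
    OutsideConic q P := by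
  set Q := r * w₂ * w₃ + s * w₁ * w₃ + t * w₁ * w₂ with hQ
  set A := s * w₃ + t * w₂ with hA
  set B := r * w₃ + t * w₁ with hB
  have hdisc : (-A ^ 2) * (-B ^ 2) < (2 * Q * t - A * B) ^ 2 := by
    have e : (2 * Q * t - A * B) ^ 2 - (-A ^ 2) * (-B ^ 2) = -4 * (Q * (r * s * t)) * w₃ ^ 2 := by
      rw [hQ, hA, hB]; ring
    have : 0 < w₃ ^ 2 := by positivity
    nlinarith [mul_pos (neg_pos.mpr hneg) this]
  obtain ⟨x, y, hxy⟩ := exists_binary_pos hdisc (by nlinarith [sq_nonneg A])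
  set p := w₁ • a + w₂ • b + w₃ • c with hp
  set z := x • a + y • b with hz
  have hform : ∀ m n : ℝ,
      q (m • p + n • z) = Q * m ^ 2 + (x * A + y * B) * m * n + t * x * y * n ^ 2 := by
    intro m n
    have : m • p + n • z = (m * w₁ + n * x) • a + (m * w₂ + n * y) • b + (m * w₃) • c := by
      rw [hp, hz]; module
    rw [this, hq, hQ, hA, hB]; ring
  have hdef : ∀ m n : ℝ, q (m • p + n • z) = 0 → m = 0 ∧ n = 0 := by
    intro m n h0
    rw [hform] at h0
    have hQ0 : Q ≠ 0 := by intro h; rw [h] at hneg; simp at hneg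
    have e : (2 * Q * m + (x * A + y * B) * n) ^ 2 +
        (-A ^ 2 * x ^ 2 + 2 * (2 * Q * t - A * B) * x * y + -B ^ 2 * y ^ 2) * n ^ 2 = 0 := by
      linear_combination 4 * Q * h0
    have hn : n = 0 := by
      by_contra hn
      have : 0 < n ^ 2 := by positivity
      nlinarith [mul_pos hxy this, sq_nonneg (2 * Q * m + (x * A + y * B) * n)]
    subst hn
    refine ⟨?_, rfl⟩
    simpa [hQ0] using h0
  have hli : LinearIndependent ℝ ![p, z] := by
    rw [LinearIndependent.pair_iff]
    intro m n h0
    exact hdef m n (by rw [h0, QuadraticMap.map_zero])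
  refine ⟨_, ⟨Submodule.span ℝ {p, z}, ?_, rfl⟩, ?_, ?_⟩
  · rw [← Matrix.range_cons_cons_empty p z ![]]
    simpa using finrank_span_eq_card hli
  · have : P.rep = k⁻¹ • p := by rw [hP, smul_smul, inv_mul_cancel₀ hk, one_smul]
    change P.rep ∈ Submodule.span ℝ {p, z}
    rw [this]
    exact Submodule.smul_mem _ _ (Submodule.subset_span (by simp))
  · rw [Set.eq_empty_iff_forall_notMem]
    rintro X ⟨hX, hX0⟩
    obtain ⟨m, n, hmn⟩ := Submodule.mem_span_pair.mp (show X.rep ∈ Submodule.span ℝ {p, z} from hX)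
    have hX0 : q X.rep = 0 := hX0
    rw [← hmn] at hX0
    obtain ⟨rfl, rfl⟩ := hdef m n hX0
    exact X.rep_nonzero (by rw [← hmn]; simp)

lemma not_outsideConic_of_pos (h : det3 a b c ≠ 0)
    (hq : ∀ x y z : ℝ, q (x • a + y • b + z • c) = r * y * z + s * x * z + t * x * y)
    (hP : w₁ • a + w₂ • b + w₃ • c = k • P.rep) (hw : w₃ ≠ 0)
    (hpos : 0 < (r * w₂ * w₃ + s * w₁ * w₃ + t * w₁ * w₂) * (r * s * t)) :
    ¬ OutsideConic q P := by
  rintro ⟨L, ⟨W, hW, rfl⟩, hPW, hempty⟩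
  set Q := r * w₂ * w₃ + s * w₁ * w₃ + t * w₁ * w₂ with hQ
  set A := s * w₃ + t * w₂ with hA
  set B := r * w₃ + t * w₁ with hB
  have hQ0 : Q ≠ 0 := by intro h; rw [h] at hpos; simp at hpos
  have hab : Module.finrank ℝ (Submodule.span ℝ {a, b}) = 2 := by
    have hli : LinearIndependent ℝ ![a, b] := by
      rw [LinearIndependent.pair_iff]
      intro x y hxy
      have := comb_eq_zero h (x := x) (y := y) (z := 0) (by simpa using hxy)
      exact ⟨this.1, this.2.1⟩
    rw [← Matrix.range_cons_cons_empty a b ![]]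
    simpa using finrank_span_eq_card hli
  have hinf : W ⊓ Submodule.span ℝ {a, b} ≠ ⊥ := by
    intro hbot
    have h1 := Submodule.finrank_sup_add_finrank_inf_eq W (Submodule.span ℝ {a, b})
    have h2 := Submodule.finrank_le (W ⊔ Submodule.span ℝ {a, b})
    rw [hbot, finrank_bot, hW, hab] at h1
    rw [Module.finrank_fin_fun] at h2
    omega
  obtain ⟨z, ⟨hzW, hzab⟩, hz0⟩ := Submodule.exists_mem_ne_zero_of_ne_bot hinf
  obtain ⟨x, y, hz⟩ := Submodule.mem_span_pair.mp hzab
  have hg : 0 ≤ (x * A + y * B) ^ 2 - 4 * Q * (t * x * y) := by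
    have hdisc : (2 * Q * t - A * B) ^ 2 ≤ A ^ 2 * B ^ 2 := by
      have e : (2 * Q * t - A * B) ^ 2 - A ^ 2 * B ^ 2 =
          -4 * (Q * (r * s * t)) * w₃ ^ 2 := by
        rw [hQ, hA, hB]; ring
      nlinarith [mul_nonneg hpos.le (sq_nonneg w₃)]
    rcases eq_or_ne A 0 with hA0 | hA0
    · have : 2 * Q * t = 0 := by
        rw [hA0] at hdisc
        have : (2 * Q * t) ^ 2 ≤ 0 := by linarith [hdisc]
        exact pow_eq_zero_iff (two_ne_zero) |>.mp (le_antisymm this (sq_nonneg _))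
      rw [hA0]
      have e : (x * 0 + y * B) ^ 2 - 4 * Q * (t * x * y) = (y * B) ^ 2 := by
        linear_combination (-2 * x * y) * this
      rw [e]
      positivity
    · have hA2 : 0 < A ^ 2 := by positivity
      have e : A ^ 2 * ((x * A + y * B) ^ 2 - 4 * Q * (t * x * y)) =
          (A ^ 2 * x - (2 * Q * t - A * B) * y) ^ 2
            + (A ^ 2 * B ^ 2 - (2 * Q * t - A * B) ^ 2) * y ^ 2 := by ring
      have : 0 ≤ A ^ 2 * ((x * A + y * B) ^ 2 - 4 * Q * (t * x * y)) := by
        rw [e]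
        have := mul_nonneg (sub_nonneg.mpr hdisc) (sq_nonneg y)
        positivity
      exact nonneg_of_mul_nonneg_right this hA2
  set m := (-(x * A + y * B) + √((x * A + y * B) ^ 2 - 4 * Q * (t * x * y))) / (2 * Q) with hm
  set v := m • (w₁ • a + w₂ • b + w₃ • c) + z with hv
  have hv' : v = (m * w₁ + x) • a + (m * w₂ + y) • b + (m * w₃) • c := by
    rw [hv, ← hz]; module
  have hqv : q v = 0 := by
    have hsq := Real.sq_sqrt hg
    have h2 : 2 * Q * m + (x * A + y * B) =
        √((x * A + y * B) ^ 2 - 4 * Q * (t * x * y)) := by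
      rw [hm]; field_simp; ring
    rw [← h2] at hsq
    have e : q v = Q * m ^ 2 + (x * A + y * B) * m + t * x * y := by
      rw [hv', hq, hQ, hA, hB]; ring
    rw [e]
    have : 4 * Q * (Q * m ^ 2 + (x * A + y * B) * m + t * x * y) = 0 := by
      linear_combination hsq
    exact (mul_eq_zero.mp this).resolve_left (by simpa using hQ0)
  have hv0 : v ≠ 0 := by
    intro h0
    obtain ⟨-, -, h3⟩ := comb_eq_zero h (hv'.symm.trans h0)
    have hm0 : m = 0 := (mul_eq_zero.mp h3).resolve_right hw
    rw [hv, hm0, zero_smul, zero_add] at h0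
    exact hz0 h0
  have hvW : v ∈ W := by
    rw [hv, hP]
    exact W.add_mem (W.smul_mem _ (W.smul_mem _ hPW)) hzW
  obtain ⟨l, hl⟩ := Projectivization.exists_smul_eq_mk_rep ℝ v hv0
  have hmem : Projectivization.mk ℝ v hv0 ∈ {p : RP2 | p.rep ∈ W} ∩ ConicSet q := by
    constructor
    · change (Projectivization.mk ℝ v hv0).rep ∈ W
      rw [← hl]
      exact W.smul_mem (l : ℝ) hvW
    · change q (Projectivization.mk ℝ v hv0).rep = 0
      rw [← hl]
      change q ((l : ℝ) • v) = 0
      rw [QuadraticMap.map_smul, hqv, smul_zero]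
  rw [hempty] at hmem
  exact hmem

end Conic

/-- The sign condition deciding the position of `w` relative to the conic through the basis
points, `d` and `u`, in terms of coordinates in that basis. -/
def pencilSign (d₁ d₂ d₃ u₁ u₂ u₃ w₁ w₂ w₃ : ℝ) : ℝ :=
  (d₁ * u₁ * (d₃ * u₂ - d₂ * u₃) * w₂ * w₃ + d₂ * u₂ * (d₁ * u₃ - d₃ * u₁) * w₁ * w₃
    + d₃ * u₃ * (d₂ * u₁ - d₁ * u₂) * w₁ * w₂)
  * (d₁ * u₁ * (d₃ * u₂ - d₂ * u₃) * (d₂ * u₂ * (d₁ * u₃ - d₃ * u₁))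
    * (d₃ * u₃ * (d₂ * u₁ - d₁ * u₂)))

lemma forall_outsideConic_iff {a b c : Fin 3 → ℝ} (h : det3 a b c ≠ 0)
    {d₁ d₂ d₃ u₁ u₂ u₃ w₁ w₂ w₃ k : ℝ} {P : RP2} (hk : k ≠ 0)
    (hP : w₁ • a + w₂ • b + w₃ • c = k • P.rep) (hw : w₃ ≠ 0)
    (hne : pencilSign d₁ d₂ d₃ u₁ u₂ u₃ w₁ w₂ w₃ ≠ 0) :
    (∀ q : QuadraticForm ℝ (Fin 3 → ℝ), q ≠ 0 → q a = 0 → q b = 0 → q c = 0 →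
      q (d₁ • a + d₂ • b + d₃ • c) = 0 → q (u₁ • a + u₂ • b + u₃ • c) = 0 → OutsideConic q P) ↔
    pencilSign d₁ d₂ d₃ u₁ u₂ u₃ w₁ w₂ w₃ < 0 := by
  unfold pencilSign at *
  set R := d₁ * u₁ * (d₃ * u₂ - d₂ * u₃) with hR
  set S := d₂ * u₂ * (d₁ * u₃ - d₃ * u₁) with hS
  set T := d₃ * u₃ * (d₂ * u₁ - d₁ * u₂) with hT
  have hR0 : R ≠ 0 := by intro h; simp [h] at hne
  constructor
  · intro hall
    by_contra hcon
    have hpos := lt_of_le_of_ne (not_lt.mp hcon) hne.symm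
    obtain ⟨q, hq⟩ := exists_quadraticForm h R S T
    refine not_outsideConic_of_pos h hq hP hw hpos (hall q ?_ ?_ ?_ ?_ ?_ ?_)
    · rintro rfl
      have := hq 0 1 1
      simp at this
      exact hR0 this.symm
    · simpa using hq 1 0 0
    · simpa using hq 0 1 0
    · simpa using hq 0 0 1
    · rw [hq, hR, hS, hT]; ring
    · rw [hq, hR, hS, hT]; ring
  · intro hneg q hq0 ha hb hc hd hu
    obtain ⟨r, s, t, hq⟩ := quadraticForm_formula q ha hb hc
    rw [hq] at hd hu
    obtain ⟨κ, rfl⟩ : ∃ κ, r = κ * R := ⟨r / R, by field_simp⟩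
    have hs : s = κ * S := by
      apply mul_left_cancel₀ hR0
      rw [hR, hS] at *
      linear_combination (u₁ * u₂) * hd - (d₁ * d₂) * hu
    have ht : t = κ * T := by
      apply mul_left_cancel₀ hR0
      rw [hR, hT] at *
      linear_combination (d₁ * d₃) * hu - (u₁ * u₃) * hd
    subst hs ht
    have hκ : κ ≠ 0 := by
      rintro rfl
      apply hq0
      ext x
      obtain ⟨x₁, x₂, x₃, rfl⟩ := exists_coord h x
      rw [hq]
      simp
    refine outsideConic_of_neg hq hk hP hw ?_
    have : 0 < κ ^ 4 := by positivity
    nlinarith [mul_neg_of_pos_of_neg this hneg]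

lemma det3_relation (u v x y : Fin 3 → ℝ) :
    det3 v x y • u + (-det3 u x y) • v + det3 u v y • x + (-det3 u v x) • y = 0 := by
  ext n
  fin_cases n <;> simp [det3] <;> ring

lemma mem_hull_of_relation {s : Set (Fin 3 → ℝ)} {u v x y : Fin 3 → ℝ} {α β γ δ : ℝ}
    (hv : v ∈ s) (hx : x ∈ s) (hy : y ∈ s)
    (h : α • u + β • v + γ • x + δ • y = 0) (hsum : α + β + γ + δ = 0)
    (h1 : α * β < 0) (h2 : α * γ < 0) (h3 : α * δ < 0) : u ∈ convexHull ℝ s := by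
  have hα : α ≠ 0 := by rintro rfl; simp at h1
  have hα2 : 0 < α ^ 2 := by positivity
  have e : ∀ {t : ℝ}, α * t < 0 → 0 ≤ -t / α := by
    intro t ht
    have : -t / α = (-(α * t)) / α ^ 2 := by field_simp
    rw [this]
    exact div_nonneg (by linarith) hα2.le
  have hu : u = (-β / α) • v + (-γ / α) • x + (-δ / α) • y := by
    have : u = α⁻¹ • (α • u) := by rw [smul_smul, inv_mul_cancel₀ hα, one_smul]
    rw [this, show α • u = -(β • v + γ • x + δ • y) by
      rw [eq_neg_iff_add_eq_zero, ← h]; abel]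
    simp only [div_eq_inv_mul]
    module
  rw [hu]
  have := (convex_convexHull ℝ s).sum_mem (t := Finset.univ) (w := ![-β / α, -γ / α, -δ / α])
    (z := ![v, x, y]) ?_ ?_ ?_
  · simpa [Fin.sum_univ_three] using this
  · intro i _
    fin_cases i
    · exact e h1
    · exact e h2
    · exact e h3
  · simp only [Fin.sum_univ_three, Matrix.cons_val]
    field_simp
    linarith
  · intro i _
    fin_cases i
    · exact subset_convexHull ℝ s hv
    · exact subset_convexHull ℝ s hx
    · exact subset_convexHull ℝ s hy

lemma prod_pos_of_signs {α β γ δ : ℝ} (hα : α ≠ 0) (hβ : β ≠ 0) (hγ : γ ≠ 0) (hδ : δ ≠ 0)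
    (n1 : α * β < 0 → α * γ < 0 → α * δ < 0 → False)
    (n2 : β * α < 0 → β * γ < 0 → β * δ < 0 → False)
    (n3 : γ * α < 0 → γ * β < 0 → γ * δ < 0 → False)
    (n4 : δ * α < 0 → δ * β < 0 → δ * γ < 0 → False) : 0 < α * β * γ * δ := by
  rcases lt_or_gt_of_ne hα with a1 | a1 <;> rcases lt_or_gt_of_ne hβ with a2 | a2 <;>
  rcases lt_or_gt_of_ne hγ with a3 | a3 <;> rcases lt_or_gt_of_ne hδ with a4 | a4 <;>
  simp [mul_pos_iff, mul_neg_iff, a1, a2, a3, a4, a1.not_gt, a2.not_gt, a3.not_gt,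
    a4.not_gt] at n1 n2 n3 n4 ⊢

/-- The diagonals of a quadrilateral in convex position. -/
lemma quadrilateral_pos {φ : (Fin 3 → ℝ) →ₗ[ℝ] ℝ} {v : Fin 7 → Fin 3 → ℝ}
    (hφ : ∀ i, φ (v i) = 1)
    (hdet : ∀ i j k : Fin 7, i ≠ j → i ≠ k → j ≠ k → det3 (v i) (v j) (v k) ≠ 0)
    (hconv : ∀ i, v i ∉ convexHull ℝ (v '' {j | j ≠ i}))
    {i j k l : Fin 7} (hij : i ≠ j) (hik : i ≠ k) (hil : i ≠ l) (hjk : j ≠ k) (hjl : j ≠ l)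
    (hkl : k ≠ l) :
    0 < det3 (v i) (v j) (v k) * det3 (v i) (v j) (v l)
      * det3 (v i) (v k) (v l) * det3 (v j) (v k) (v l) := by
  have hrel := det3_relation (v i) (v j) (v k) (v l)
  have hsum := congrArg φ hrel
  simp only [map_add, map_smul, hφ, smul_eq_mul, mul_one, map_zero] at hsum
  have hα := hdet j k l hjk hjl hkl
  have hβ := neg_ne_zero.mpr (hdet i k l hik hil hkl)
  have hγ := hdet i j l hij hil hjl
  have hδ := neg_ne_zero.mpr (hdet i j k hij hik hjk)
  have mem : ∀ {x y : Fin 7}, x ≠ y → v x ∈ v '' {j | j ≠ y} := fun h => ⟨_, h, rfl⟩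
  rw [show det3 (v i) (v j) (v k) * det3 (v i) (v j) (v l) * det3 (v i) (v k) (v l)
    * det3 (v j) (v k) (v l) = det3 (v j) (v k) (v l) * (-det3 (v i) (v k) (v l))
      * det3 (v i) (v j) (v l) * (-det3 (v i) (v j) (v k)) by ring]
  generalize det3 (v j) (v k) (v l) = α at *
  generalize -det3 (v i) (v k) (v l) = β at *
  generalize det3 (v i) (v j) (v l) = γ at *
  generalize -det3 (v i) (v j) (v k) = δ at *
  have n1 := fun h1 h2 h3 => hconv i (mem_hull_of_relation (mem hij.symm) (mem hik.symm)
    (mem hil.symm) hrel hsum h1 h2 h3)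
  have n2 := fun h1 h2 h3 => hconv j (mem_hull_of_relation (α := β) (β := α) (γ := γ) (δ := δ)
    (mem hij) (mem hjk.symm) (mem hjl.symm) (by rw [← hrel]; abel) (by linarith) h1 h2 h3)
  have n3 := fun h1 h2 h3 => hconv k (mem_hull_of_relation (α := γ) (β := α) (γ := β) (δ := δ)
    (mem hik) (mem hjk) (mem hkl.symm) (by rw [← hrel]; abel) (by linarith) h1 h2 h3)
  have n4 := fun h1 h2 h3 => hconv l (mem_hull_of_relation (α := δ) (β := α) (γ := β) (δ := γ)
    (mem hil) (mem hjl) (mem hkl) (by rw [← hrel]; abel) (by linarith) h1 h2 h3)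
  exact prod_pos_of_signs hα hβ hγ hδ n1 n2 n3 n4

/-- Data of vectors representing the points of a typical configuration, with the sign relations
between determinants that express convex position. -/
structure Lift (f : Fin 7 → RP2) (v : Fin 7 → Fin 3 → ℝ) : Prop where
  rep : ∀ i, ∃ k : ℝ, k ≠ 0 ∧ v i = k • (f i).rep
  det : ∀ i j k : Fin 7, i ≠ j → i ≠ k → j ≠ k → det3 (v i) (v j) (v k) ≠ 0
  quad : ∀ i j k l : Fin 7, i ≠ j → i ≠ k → i ≠ l → j ≠ k → j ≠ l → k ≠ l →
    0 < det3 (v i) (v j) (v k) * det3 (v i) (v j) (v l)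
      * det3 (v i) (v k) (v l) * det3 (v j) (v k) (v l)
  noncoconic : ∀ q : QuadraticForm ℝ (Fin 3 → ℝ), q ≠ 0 → ∀ j, ∃ k, k ≠ j ∧ q (v k) ≠ 0

lemma Lift.perm {f : Fin 7 → RP2} {v : Fin 7 → Fin 3 → ℝ} (h : Lift f v)
    (e : Equiv.Perm (Fin 7)) : Lift (f ∘ e) (v ∘ e) where
  rep i := h.rep (e i)
  det i j k h1 h2 h3 := h.det _ _ _ (e.injective.ne h1) (e.injective.ne h2) (e.injective.ne h3)
  quad i j k l h1 h2 h3 h4 h5 h6 := h.quad _ _ _ _ (e.injective.ne h1) (e.injective.ne h2)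
    (e.injective.ne h3) (e.injective.ne h4) (e.injective.ne h5) (e.injective.ne h6)
  noncoconic q hq j := by
    obtain ⟨k, hk, hk'⟩ := h.noncoconic q hq (e j)
    exact ⟨e.symm k, by rintro rfl; simp at hk, by simpa using hk'⟩

lemma outAll_perm (f : Fin 7 → RP2) (e : Equiv.Perm (Fin 7)) (i j : Fin 7) :
    OutAll (f ∘ e) i j ↔ OutAll f (e i) (e j) := by
  unfold OutAll
  refine forall₂_congr fun q _ => imp_congr_left ?_
  rw [← e.forall_congr_right (q := fun k => k ≠ e i → k ≠ e j → q ((f k).rep) = 0)]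
  simp

lemma Lift.map_eq_zero_iff {f : Fin 7 → RP2} {v : Fin 7 → Fin 3 → ℝ} (h : Lift f v)
    (q : QuadraticForm ℝ (Fin 3 → ℝ)) (i : Fin 7) : q ((f i).rep) = 0 ↔ q (v i) = 0 := by
  obtain ⟨k, hk, e⟩ := h.rep i
  rw [e, QuadraticMap.map_smul]
  simp [hk]

lemma Lift.exists_lift {f : Fin 7 → RP2} (hf : TypicalCfg f) (hconv : ConvexPos f) :
    ∃ v, Lift f v := by
  obtain ⟨φ, -, hne, hhull⟩ := hconv
  have hrep : ∀ i, ∃ k : ℝ, k ≠ 0 ∧ chart φ (f i) = k • (f i).rep :=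
    fun i => ⟨_, inv_ne_zero (hne i), rfl⟩
  have hdet : ∀ i j k : Fin 7, i ≠ j → i ≠ k → j ≠ k →
      det3 (chart φ (f i)) (chart φ (f j)) (chart φ (f k)) ≠ 0 := by
    intro i j k h1 h2 h3
    have hli := not_not.mp (hf.1.2 i j k h1 h2 h3)
    have hu := Matrix.linearIndependent_rows_iff_isUnit
      (A := Matrix.of ![(f i).rep, (f j).rep, (f k).rep]) |>.mp hli
    have hd := (Matrix.isUnit_iff_isUnit_det _).mp hu |>.ne_zero
    rw [Matrix.det_fin_three] at hd
    simp at hd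
    have e : det3 (chart φ (f i)) (chart φ (f j)) (chart φ (f k)) =
        (φ (f i).rep)⁻¹ * (φ (f j).rep)⁻¹ * (φ (f k).rep)⁻¹ *
          det3 (f i).rep (f j).rep (f k).rep := by
      simp only [det3, chart, Pi.smul_apply, smul_eq_mul]
      ring
    rw [e]
    refine mul_ne_zero (mul_ne_zero (mul_ne_zero ?_ ?_) ?_) ?_
    · exact inv_ne_zero (hne _)
    · exact inv_ne_zero (hne _)
    · exact inv_ne_zero (hne _)
    · convert hd using 1
      unfold det3
      ring
  refine ⟨fun i => chart φ (f i), hrep, hdet, ?_, ?_⟩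
  · intro i j k l h1 h2 h3 h4 h5 h6
    refine quadrilateral_pos (v := fun i => chart φ (f i)) (φ := φ) ?_ hdet ?_ h1 h2 h3 h4 h5 h6
    · intro i
      simp [chart, hne i]
    · intro i
      have := hhull i
      rwa [Set.image_image] at this
  · intro q hq j
    by_contra! hcon
    refine hf.2 j.succAbove Fin.succAbove_right_injective ⟨q, hq, ?_⟩
    rintro _ ⟨m, rfl⟩
    have h0 := hcon (j.succAbove m) (Fin.succAbove_ne j m)
    obtain ⟨k, hk, e⟩ := hrep (j.succAbove m)
    rw [e, QuadraticMap.map_smul] at h0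
    simpa [hk] using h0

lemma Lift.outAll_iff {f : Fin 7 → RP2} {v : Fin 7 → Fin 3 → ℝ} (h : Lift f v)
    (hpos : 0 < det3 (v 0) (v 1) (v 3) * det3 (v 0) (v 1) (v 4)
      * det3 (v 0) (v 1) (v 5) * det3 (v 0) (v 1) (v 6)) :
    OutAll f 0 2 ↔ ¬ OutAll f 1 2 := by
  have hD : det3 (v 3) (v 4) (v 5) ≠ 0 := h.det _ _ _ (by decide) (by decide) (by decide)
  have hall : 0 < (det3 (v 0) (v 3) (v 4) * det3 (v 1) (v 3) (v 4))
      * (det3 (v 0) (v 3) (v 5) * det3 (v 1) (v 3) (v 5))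
      * (det3 (v 0) (v 3) (v 6) * det3 (v 1) (v 3) (v 6))
      * (det3 (v 0) (v 4) (v 5) * det3 (v 1) (v 4) (v 5))
      * (det3 (v 0) (v 4) (v 6) * det3 (v 1) (v 4) (v 6))
      * (det3 (v 0) (v 5) (v 6) * det3 (v 1) (v 5) (v 6)) := by
    have quad := fun k l (h0 : 0 ≠ k) (h1 : 1 ≠ k) (h2 : 0 ≠ l) (h3 : 1 ≠ l) (h4 : k ≠ l) =>
      h.quad 0 1 k l (by decide) h0 h2 h1 h3 h4
    have p1 := quad 3 4 (by decide) (by decide) (by decide) (by decide) (by decide)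
    have p2 := quad 3 5 (by decide) (by decide) (by decide) (by decide) (by decide)
    have p3 := quad 3 6 (by decide) (by decide) (by decide) (by decide) (by decide)
    have p4 := quad 4 5 (by decide) (by decide) (by decide) (by decide) (by decide)
    have p5 := quad 4 6 (by decide) (by decide) (by decide) (by decide) (by decide)
    have p6 := quad 5 6 (by decide) (by decide) (by decide) (by decide) (by decide)
    refine pos_of_mul_pos_right (a := (det3 (v 0) (v 1) (v 3) * det3 (v 0) (v 1) (v 4)
      * det3 (v 0) (v 1) (v 5) * det3 (v 0) (v 1) (v 6)) ^ 3) ?_ (pow_pos hpos 3).le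
    refine lt_of_lt_of_eq (mul_pos (mul_pos (mul_pos p1 p2) (mul_pos p3 p4)) (mul_pos p5 p6)) ?_
    ring
  have hd := fun i j (h1 : i ≠ j) (h2 : i ≠ 6) (h3 : j ≠ 6) => h.det 6 i j h2.symm h3.symm h1
  have hd₁ := hd 4 5 (by decide) (by decide) (by decide)
  have hd₂ := hd 5 3 (by decide) (by decide) (by decide)
  have hd₃ := hd 3 4 (by decide) (by decide) (by decide)
  obtain ⟨w₁, w₂, w₃, hw⟩ := exists_coord hD (v 0)
  obtain ⟨u₁, u₂, u₃, hu⟩ := exists_coord hD (v 1)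
  obtain ⟨d₁, d₂, d₃, hd⟩ := exists_coord hD (v 6)
  rw [hd, det3_coord₁] at hd₁
  rw [hd, det3_coord₂] at hd₂
  rw [hd, det3_coord₃] at hd₃
  have hd₁ := right_ne_zero_of_mul hd₁
  have hd₂ := right_ne_zero_of_mul hd₂
  have hd₃ := right_ne_zero_of_mul hd₃
  have hE : 0 < (w₁ * w₂ * w₃ * ((d₃ * w₂ - d₂ * w₃) * (d₁ * w₃ - d₃ * w₁) * (d₂ * w₁ - d₁ * w₂)))
      * (u₁ * u₂ * u₃ * ((d₃ * u₂ - d₂ * u₃) * (d₁ * u₃ - d₃ * u₁) * (d₂ * u₁ - d₁ * u₂))) := by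
    refine pos_of_mul_pos_right (a := det3 (v 3) (v 4) (v 5) ^ 12) (hall.trans_eq ?_)
      (by positivity)
    rw [hw, hu, hd]
    simp only [det3_coord₁, det3_coord_swap₂, det3_coord₃, det3_coord_left, det3_coord_middle,
      det3_coord_right]
    ring
  have hN : d₁ * u₁ * (d₃ * u₂ - d₂ * u₃) * w₂ * w₃ + d₂ * u₂ * (d₁ * u₃ - d₃ * u₁) * w₁ * w₃
      + d₃ * u₃ * (d₂ * u₁ - d₁ * u₂) * w₁ * w₂ ≠ 0 := by
    intro hN
    obtain ⟨q, hq⟩ := exists_quadraticForm hD (d₁ * u₁ * (d₃ * u₂ - d₂ * u₃))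
      (d₂ * u₂ * (d₁ * u₃ - d₃ * u₁)) (d₃ * u₃ * (d₂ * u₁ - d₁ * u₂))
    have hq0 : q ≠ 0 := by
      rintro rfl
      have h0 := hq 0 1 1
      have : d₁ * (u₁ * (d₃ * u₂ - d₂ * u₃)) = 0 := by simpa [mul_assoc] using h0.symm
      have := (mul_eq_zero.mp this).resolve_left hd₁
      refine hE.ne' ?_
      linear_combination (w₁ * w₂ * w₃ * ((d₃ * w₂ - d₂ * w₃) * (d₁ * w₃ - d₃ * w₁)
        * (d₂ * w₁ - d₁ * w₂)) * u₂ * u₃ * (d₁ * u₃ - d₃ * u₁) * (d₂ * u₁ - d₁ * u₂)) * this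
    obtain ⟨m, hm, hqm⟩ := h.noncoconic q hq0 2
    apply hqm
    have h3 := hq 1 0 0
    have h4 := hq 0 1 0
    have h5 := hq 0 0 1
    simp only [one_smul, zero_smul, zero_add, add_zero, mul_zero, zero_mul] at h3 h4 h5
    fin_cases m
    · exact (congrArg q hw).trans ((hq _ _ _).trans hN)
    · refine (congrArg q hu).trans ((hq _ _ _).trans ?_)
      ring
    · exact absurd rfl hm
    · exact h3
    · exact h4
    · exact h5
    · refine (congrArg q hd).trans ((hq _ _ _).trans ?_)
      ring
  have hσ : pencilSign d₁ d₂ d₃ u₁ u₂ u₃ w₁ w₂ w₃ * pencilSign d₁ d₂ d₃ w₁ w₂ w₃ u₁ u₂ u₃ < 0 := by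
    have hN2 := pow_pos (abs_pos.mpr hN) 2
    rw [sq_abs] at hN2
    have hd2 : 0 < (d₁ * d₂ * d₃) ^ 2 := by positivity
    rw [← neg_pos]
    refine lt_of_lt_of_eq (mul_pos (mul_pos hN2 hd2) hE) ?_
    have hN' : d₁ * w₁ * (d₃ * w₂ - d₂ * w₃) * u₂ * u₃ + d₂ * w₂ * (d₁ * w₃ - d₃ * w₁) * u₁ * u₃
        + d₃ * w₃ * (d₂ * w₁ - d₁ * w₂) * u₁ * u₂
      = -(d₁ * u₁ * (d₃ * u₂ - d₂ * u₃) * w₂ * w₃ + d₂ * u₂ * (d₁ * u₃ - d₃ * u₁) * w₁ * w₃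
        + d₃ * u₃ * (d₂ * u₁ - d₁ * u₂) * w₁ * w₂) := by ring
    unfold pencilSign
    rw [hN']
    generalize d₁ * u₁ * (d₃ * u₂ - d₂ * u₃) * w₂ * w₃ + d₂ * u₂ * (d₁ * u₃ - d₃ * u₁) * w₁ * w₃
      + d₃ * u₃ * (d₂ * u₁ - d₁ * u₂) * w₁ * w₂ = N
    generalize d₃ * u₂ - d₂ * u₃ = A₁, d₁ * u₃ - d₃ * u₁ = A₂, d₂ * u₁ - d₁ * u₂ = A₃,
      d₃ * w₂ - d₂ * w₃ = B₁, d₁ * w₃ - d₃ * w₁ = B₂, d₂ * w₁ - d₁ * w₂ = B₃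
    ring
  have hw₃ : w₃ ≠ 0 := by rintro rfl; simp at hE
  have hu₃ : u₃ ≠ 0 := by rintro rfl; simp at hE
  obtain ⟨k, hk, hkP⟩ := h.rep 0
  obtain ⟨l, hl, hlP⟩ := h.rep 1
  have H0 := forall_outsideConic_iff hD hk (hw.symm.trans hkP) hw₃ (left_ne_zero_of_mul hσ.ne)
  have H1 := forall_outsideConic_iff hD hl (hu.symm.trans hlP) hu₃ (right_ne_zero_of_mul hσ.ne)
  rw [← hd, ← hu] at H0
  rw [← hd, ← hw] at H1
  have O0 : OutAll f 0 2 ↔ pencilSign d₁ d₂ d₃ u₁ u₂ u₃ w₁ w₂ w₃ < 0 := by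
    rw [← H0]
    refine forall₂_congr fun q _ => ⟨fun H h3 h4 h5 h6 h1 => H fun k hk0 hk2 => ?_,
      fun H hk => ?_⟩
    · rw [h.map_eq_zero_iff]
      fin_cases k <;> first | assumption | exact absurd rfl ‹_›
    · have hz : ∀ k, k ≠ 0 → k ≠ 2 → q (v k) = 0 :=
        fun k h0 h2 => (h.map_eq_zero_iff q k).mp (hk k h0 h2)
      exact H (hz 3 (by decide) (by decide)) (hz 4 (by decide) (by decide))
        (hz 5 (by decide) (by decide)) (hz 6 (by decide) (by decide))
        (hz 1 (by decide) (by decide))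
  have O1 : OutAll f 1 2 ↔ pencilSign d₁ d₂ d₃ w₁ w₂ w₃ u₁ u₂ u₃ < 0 := by
    rw [← H1]
    refine forall₂_congr fun q _ => ⟨fun H h3 h4 h5 h6 h0 => H fun k hk0 hk2 => ?_,
      fun H hk => ?_⟩
    · rw [h.map_eq_zero_iff]
      fin_cases k <;> first | assumption | exact absurd rfl ‹_›
    · have hz : ∀ k, k ≠ 1 → k ≠ 2 → q (v k) = 0 :=
        fun k h0 h2 => (h.map_eq_zero_iff q k).mp (hk k h0 h2)
      exact H (hz 3 (by decide) (by decide)) (hz 4 (by decide) (by decide))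
        (hz 5 (by decide) (by decide)) (hz 6 (by decide) (by decide))
        (hz 0 (by decide) (by decide))
  rw [O0, O1, not_lt]
  rcases mul_neg_iff.mp hσ with ⟨h1, h2⟩ | ⟨h1, h2⟩
  · exact iff_of_false h1.not_gt h2.not_ge
  · exact iff_of_true h1 h2.le

lemma exists_erase_prod_pos {a b c d e : ℝ} (ha : a ≠ 0) (hb : b ≠ 0) (hc : c ≠ 0)
    (hd : d ≠ 0) (he : e ≠ 0) :
    0 < b * c * d * e ∨ 0 < a * c * d * e ∨ 0 < b * a * d * e ∨ 0 < b * c * a * e ∨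
      0 < b * c * d * a := by
  by_contra! hcon
  obtain ⟨h1, h2, h3, h4, h5⟩ := hcon
  have k : 0 ≤ (b * c * d * e) * (a * c * d * e) * ((b * a * d * e) * (b * c * a * e)) :=
    mul_nonneg (mul_nonneg_of_nonpos_of_nonpos h1 h2) (mul_nonneg_of_nonpos_of_nonpos h3 h4)
  have k5 := mul_nonpos_of_nonneg_of_nonpos k h5
  have : 0 < (a * b * c * d * e) ^ 4 := by positivity
  nlinarith

lemma exists_outAll_iff_not {f : Fin 7 → RP2} (hf : TypicalCfg f) (hconv : ConvexPos f)
    {i k : Fin 7} (hik : i ≠ k) :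
    ∃ j, j ≠ i ∧ j ≠ k ∧ (OutAll f i j ↔ ¬ OutAll f k j) := by
  obtain ⟨v, hv⟩ := Lift.exists_lift hf hconv
  obtain ⟨e, rfl, rfl⟩ : ∃ e : Equiv.Perm (Fin 7), e 0 = i ∧ e 1 = k := by
    have hm : Equiv.swap 0 i k ≠ 0 := by
      intro h
      rw [Equiv.swap_apply_eq_iff, Equiv.swap_apply_left] at h
      exact hik h.symm
    refine ⟨Equiv.swap 0 i * Equiv.swap 1 (Equiv.swap 0 i k), ?_, ?_⟩
    · rw [Equiv.Perm.mul_apply, Equiv.swap_apply_of_ne_of_ne (by decide) hm.symm,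
        Equiv.swap_apply_left]
    · rw [Equiv.Perm.mul_apply, Equiv.swap_apply_left, Equiv.swap_apply_self]
  have hd : ∀ m : Fin 7, 0 ≠ m → 1 ≠ m → det3 (v (e 0)) (v (e 1)) (v (e m)) ≠ 0 :=
    fun m h0 h1 => hv.det _ _ _ hik (e.injective.ne h0) (e.injective.ne h1)
  have reduce : ∀ m : Fin 7, m ≠ 0 → m ≠ 1 →
      (0 < det3 (v (e 0)) (v (e 1)) (v (e (Equiv.swap 2 m 3))) *
        det3 (v (e 0)) (v (e 1)) (v (e (Equiv.swap 2 m 4))) *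
        det3 (v (e 0)) (v (e 1)) (v (e (Equiv.swap 2 m 5))) *
        det3 (v (e 0)) (v (e 1)) (v (e (Equiv.swap 2 m 6)))) →
      ∃ j, j ≠ e 0 ∧ j ≠ e 1 ∧ (OutAll f (e 0) j ↔ ¬ OutAll f (e 1) j) := by
    intro m h0 h1 hpos
    have s0 : Equiv.swap 2 m 0 = 0 := Equiv.swap_apply_of_ne_of_ne (by decide) h0.symm
    have s1 : Equiv.swap 2 m 1 = 1 := Equiv.swap_apply_of_ne_of_ne (by decide) h1.symm
    refine ⟨e m, e.injective.ne h0, e.injective.ne h1, ?_⟩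
    have := (hv.perm (e * Equiv.swap 2 m)).outAll_iff (by
      simpa only [Function.comp_apply, Equiv.Perm.mul_apply, s0, s1] using hpos)
    rw [outAll_perm, outAll_perm] at this
    simpa only [Equiv.Perm.mul_apply, s0, s1, Equiv.swap_apply_left] using this
  rcases exists_erase_prod_pos (hd 2 (by decide) (by decide)) (hd 3 (by decide) (by decide))
    (hd 4 (by decide) (by decide)) (hd 5 (by decide) (by decide)) (hd 6 (by decide) (by decide))
    with h | h | h | h | h
  · exact reduce 2 (by decide) (by decide) h
  · exact reduce 3 (by decide) (by decide) h
  · exact reduce 4 (by decide) (by decide) h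
  · exact reduce 5 (by decide) (by decide) h
  · exact reduce 6 (by decide) (by decide) h

lemma dIdx_le_one (f : Fin 7 → RP2) (i j : Fin 7) : dIdx f i j ≤ 1 := by
  unfold dIdx
  split_ifs <;> simp

lemma outAll_of_domIdx_eq_six {f : Fin 7 → RP2} {i j : Fin 7} (h : domIdx f i = 6) (hj : j ≠ i) :
    OutAll f i j := by
  by_contra hcon
  have h0 : dIdx f i j = 0 := if_neg hcon
  have hlt : domIdx f i < ∑ _m ∈ Finset.univ.erase i, 1 :=
    Finset.sum_lt_sum (fun m _ => dIdx_le_one f i m) ⟨j, by simpa using hj, by omega⟩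
  simp [h] at hlt

lemma not_outAll_of_domIdx_eq_zero {f : Fin 7 → RP2} {i j : Fin 7} (h : domIdx f i = 0)
    (hj : j ≠ i) : ¬ OutAll f i j := by
  intro hout
  have h1 : dIdx f i j = 1 := if_pos hout
  have := Finset.sum_eq_zero_iff.mp h j (by simpa using hj)
  omega

/-- A heptagonal typical 7-configuration has at most one point of dominance index 6 and at
most one point of dominance index 0. -/
theorem at_most_one_extremal_dominance (f : Fin 7 → RP2)
    (hf : TypicalCfg f) (hconv : ConvexPos f) :
    (∀ i j : Fin 7, domIdx f i = 6 → domIdx f j = 6 → i = j) ∧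
    (∀ i j : Fin 7, domIdx f i = 0 → domIdx f j = 0 → i = j) := by
  constructor
  · intro i k hi hk
    by_contra hik
    obtain ⟨j, hji, hjk, hj⟩ := exists_outAll_iff_not hf hconv hik
    exact hj.mp (outAll_of_domIdx_eq_six hi hji) (outAll_of_domIdx_eq_six hk hjk)
  · intro i k hi hk
    by_contra hik
    obtain ⟨j, hji, hjk, hj⟩ := exists_outAll_iff_not hf hconv hik
    exact not_outAll_of_domIdx_eq_zero hi hji (hj.mpr (not_outAll_of_domIdx_eq_zero hk hjk))

end
end

section
/- Let P be a heptagonal typical 7-configuration with points p₀,…,p₆ numbered consecutively along the cyclic order coming from convex position (indices modulo 7). If d(p_i) ∉ {0, 6}, then d_{i,i+1} = d_{i+1,i} and d_{i,i−1} = d_{i−1,i}. -/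
open scoped LinearAlgebra.Projectivization
open Projectivization

noncomputable section

section Bracket

/-- The functional `y ↦ ε * det (a, b, y)` on `ℝ³`. -/
def bracket (ε : ℝ) (a b : Fin 3 → ℝ) : (Fin 3 → ℝ) →ₗ[ℝ] ℝ :=
  (ε * (a 1 * b 2 - a 2 * b 1)) • LinearMap.proj 0 +
    (ε * (a 2 * b 0 - a 0 * b 2)) • LinearMap.proj 1 +
    (ε * (a 0 * b 1 - a 1 * b 0)) • LinearMap.proj 2

theorem bracket_apply (ε : ℝ) (a b y : Fin 3 → ℝ) :
    bracket ε a b y = ε * (a 1 * b 2 - a 2 * b 1) * y 0 + ε * (a 2 * b 0 - a 0 * b 2) * y 1 +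
      ε * (a 0 * b 1 - a 1 * b 0) * y 2 := by
  simp [bracket]

theorem bracket_rotate (ε : ℝ) (a b c : Fin 3 → ℝ) : bracket ε b c a = bracket ε a b c := by
  simp only [bracket_apply]; ring

theorem bracket_swap_right (ε : ℝ) (a b c : Fin 3 → ℝ) : bracket ε a c b = -bracket ε a b c := by
  simp only [bracket_apply]; ring

@[simp] theorem bracket_self_left (ε : ℝ) (a b : Fin 3 → ℝ) : bracket ε a b a = 0 := by
  simp only [bracket_apply]; ring

@[simp] theorem bracket_self_right (ε : ℝ) (a b : Fin 3 → ℝ) : bracket ε a b b = 0 := by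
  simp only [bracket_apply]; ring

theorem bracket_cramer (ε : ℝ) (a b c y : Fin 3 → ℝ) :
    bracket ε a b c • y =
      bracket ε y b c • a + bracket ε a y c • b + bracket ε a b y • c := by
  ext k
  simp only [bracket_apply, Pi.add_apply, Pi.smul_apply, smul_eq_mul]
  fin_cases k <;> simp <;> ring

theorem eq_combination_of_bracket_ne_zero {ε : ℝ} {a b c : Fin 3 → ℝ}
    (h : bracket ε a b c ≠ 0) (y : Fin 3 → ℝ) :
    y = (bracket ε y b c / bracket ε a b c) • a + (bracket ε a y c / bracket ε a b c) • b +
      (bracket ε a b y / bracket ε a b c) • c := by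
  simp only [div_eq_inv_mul, mul_smul]
  rw [← smul_add, ← smul_add, ← bracket_cramer, smul_smul, inv_mul_cancel₀ h, one_smul]

/-- Three-term Grassmann–Plücker relation. -/
theorem bracket_plucker (ε : ℝ) (a b c d e : Fin 3 → ℝ) :
    bracket ε a b c * bracket ε a d e - bracket ε a b d * bracket ε a c e +
      bracket ε a b e * bracket ε a c d = 0 := by
  simp only [bracket_apply]; ring

theorem bracket_eq_mul_det (ε : ℝ) (a b c : Fin 3 → ℝ) :
    bracket ε a b c = ε * Matrix.det (Matrix.of ![a, b, c]) := by
  simp only [bracket_apply, Matrix.det_fin_three, Matrix.of_apply, Matrix.cons_val_zero,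
    Matrix.cons_val_one, Matrix.cons_val]
  ring

theorem bracket_ne_zero {ε : ℝ} (hε : ε ≠ 0) {a b c : Fin 3 → ℝ}
    (h : LinearIndependent ℝ ![a, b, c]) : bracket ε a b c ≠ 0 := by
  rw [bracket_eq_mul_det]
  refine mul_ne_zero hε (IsUnit.ne_zero ?_)
  rw [← Matrix.isUnit_iff_isUnit_det, ← Matrix.linearIndependent_rows_iff_isUnit]
  exact h

/-- A functional vanishing at `a` and `b` is proportional to `bracket ε a b`. -/
theorem map_mul_bracket_comm (ε : ℝ) {a b : Fin 3 → ℝ} (M : (Fin 3 → ℝ) →ₗ[ℝ] ℝ)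
    (ha : M a = 0) (hb : M b = 0) (x y : Fin 3 → ℝ) :
    M x * bracket ε a b y = M y * bracket ε a b x := by
  have h := congrArg M (bracket_cramer ε a b x y)
  simp only [map_add, map_smul, ha, hb, smul_eq_mul, mul_zero, zero_add] at h
  linarith

end Bracket

section ConicCriterion

open QuadraticMap

theorem map_pair_combination (q : QuadraticForm ℝ (Fin 3 → ℝ)) (s t : ℝ) (a b : Fin 3 → ℝ) :
    q (s • a + t • b) = s * s * q a + t * t * q b + s * t * polar q a b := by
  rw [QuadraticMap.map_add q, QuadraticMap.map_smul, QuadraticMap.map_smul,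
    QuadraticMap.polar_smul_left, QuadraticMap.polar_smul_right]
  simp only [smul_eq_mul]; ring

theorem map_triple_combination (q : QuadraticForm ℝ (Fin 3 → ℝ)) (x y z : ℝ)
    {a b c : Fin 3 → ℝ} (ha : q a = 0) (hb : q b = 0) (hc : q c = 0) :
    q (x • a + y • b + z • c) =
      x * y * polar q a b + x * z * polar q a c + y * z * polar q b c := by
  rw [QuadraticMap.map_add q, QuadraticMap.map_smul, map_pair_combination,
    QuadraticMap.polar_smul_right, QuadraticMap.polar_add_left, QuadraticMap.polar_smul_left,
    QuadraticMap.polar_smul_left, ha, hb, hc]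
  simp only [smul_eq_mul]; ring

theorem polar_combination (q : QuadraticForm ℝ (Fin 3 → ℝ)) (x y z s t : ℝ)
    {a b c : Fin 3 → ℝ} (ha : q a = 0) (hb : q b = 0) :
    polar q (x • a + y • b + z • c) (s • a + t • b) =
      s * (y * polar q a b + z * polar q a c) + t * (x * polar q a b + z * polar q b c) := by
  have haa : polar q a a = 0 := by simp [QuadraticMap.polar_self, ha]
  have hbb : polar q b b = 0 := by simp [QuadraticMap.polar_self, hb]
  simp only [QuadraticMap.polar_add_left, QuadraticMap.polar_add_right,
    QuadraticMap.polar_smul_left, QuadraticMap.polar_smul_right, smul_eq_mul, haa, hbb,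
    QuadraticMap.polar_comm q b a, QuadraticMap.polar_comm q c a, QuadraticMap.polar_comm q c b]
  ring

/-- If `q p * q w` exceeds the square of the polar term, then `q` has no zero on the line
spanned by `p` and `w`. -/
theorem eq_zero_of_map_pair_eq_zero (q : QuadraticForm ℝ (Fin 3 → ℝ)) {p w : Fin 3 → ℝ}
    (h : polar q p w ^ 2 < 4 * q p * q w) {r u : ℝ} (h0 : q (r • p + u • w) = 0) :
    r = 0 ∧ u = 0 := by
  rw [map_pair_combination] at h0
  have hu : u = 0 := by
    by_contra hu
    have : 0 < u ^ 2 * (4 * q p * q w - polar q p w ^ 2) := by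
      have := sq_pos_of_ne_zero hu
      exact mul_pos this (by linarith)
    have h1 : (2 * q p * r + u * polar q p w) ^ 2 +
        u ^ 2 * (4 * q p * q w - polar q p w ^ 2) =
          4 * q p * (r * r * q p + u * u * q w + r * u * polar q p w) := by ring
    rw [h0, mul_zero] at h1
    linarith [sq_nonneg (2 * q p * r + u * polar q p w)]
  subst hu
  refine ⟨?_, rfl⟩
  have hp : q p ≠ 0 := by
    intro hp
    rw [hp] at h
    nlinarith [sq_nonneg (polar q p w)]
  have : r * r * q p = 0 := by linarith
  simpa [hp] using this

theorem outsideConic_of_sq_polar_lt (q : QuadraticForm ℝ (Fin 3 → ℝ)) (P : RP2)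
    {w : Fin 3 → ℝ} (h : polar q P.rep w ^ 2 < 4 * q P.rep * q w) : OutsideConic q P := by
  have hli : LinearIndependent ℝ ![P.rep, w] := by
    rw [LinearIndependent.pair_iff]
    intro r u hru
    exact eq_zero_of_map_pair_eq_zero q h (by rw [hru, QuadraticMap.map_zero])
  refine ⟨_, ⟨Submodule.span ℝ (Set.range ![P.rep, w]), ?_, rfl⟩, ?_, ?_⟩
  · rw [finrank_span_eq_card hli]; simp
  · exact Submodule.subset_span ⟨0, rfl⟩
  · rw [Set.eq_empty_iff_forall_notMem]
    rintro x ⟨hx, hqx⟩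
    simp only [Set.mem_ofPred_eq, Matrix.range_cons, Matrix.range_empty, Set.union_empty,
      Set.singleton_union, Submodule.mem_span_pair] at hx
    obtain ⟨r, u, hru⟩ := hx
    have hq : q x.rep = 0 := hqx
    rw [← hru] at hq
    obtain ⟨rfl, rfl⟩ := eq_zero_of_map_pair_eq_zero q h hq
    exact x.rep_nonzero (by rw [← hru]; simp)

theorem exists_map_smul_add_eq_zero (q : QuadraticForm ℝ (Fin 3 → ℝ)) {p w : Fin 3 → ℝ}
    (hp : q p ≠ 0) (h : 4 * q p * q w ≤ polar q p w ^ 2) : ∃ r : ℝ, q (r • p + w) = 0 := by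
  obtain ⟨r, hr⟩ := exists_quadratic_eq_zero (a := q p) (b := polar q p w) (c := q w) hp
    ⟨√(discrim (q p) (polar q p w) (q w)), by
      rw [Real.mul_self_sqrt]; unfold discrim; linarith⟩
  refine ⟨r, ?_⟩
  have := map_pair_combination q r 1 p w
  rw [one_smul] at this
  rw [this]; linarith

theorem exists_sq_lt_of_neg {A B C x y z : ℝ} (hABC : 0 < A * B * C) (hz : z ≠ 0)
    (hP : x * y * C + x * z * B + y * z * A < 0) :
    ∃ s t : ℝ, (s * (y * C + z * B) + t * (x * C + z * A)) ^ 2 <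
      4 * (x * y * C + x * z * B + y * z * A) * (s * t * C) := by
  set P := x * y * C + x * z * B + y * z * A with hPdef
  set m := y * C + z * B with hm
  set n := x * C + z * A with hn
  have hC : C ≠ 0 := by rintro rfl; simp at hABC
  have hP0 : P ≠ 0 := hP.ne
  have hPC : P * C ≠ 0 := mul_ne_zero hP0 hC
  have hkey : P * C - m * n = -(z ^ 2 * (A * B)) := by rw [hPdef, hm, hn]; ring
  have hz2 := sq_pos_of_ne_zero hz
  have hPABC : 0 < z ^ 2 * (A * B) * -(P * C) := by
    have := mul_pos (mul_pos hz2 hABC) (neg_pos.2 hP)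
    linarith
  by_cases hm0 : m = 0
  · refine ⟨(n ^ 2 + 1) / (4 * (P * C)), 1, ?_⟩
    have : 4 * P * ((n ^ 2 + 1) / (4 * (P * C)) * 1 * C) = n ^ 2 + 1 := by
      field_simp
    rw [this, hm0]; nlinarith
  by_cases hn0 : n = 0
  · refine ⟨1, (m ^ 2 + 1) / (4 * (P * C)), ?_⟩
    have : 4 * P * (1 * ((m ^ 2 + 1) / (4 * (P * C))) * C) = m ^ 2 + 1 := by
      field_simp
    rw [this, hn0]; nlinarith
  have hmn : m * n ≠ 0 := mul_ne_zero hm0 hn0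
  rcases lt_or_gt_of_ne (mul_ne_zero hPC hmn) with h | h
  · exact ⟨n, -m, by nlinarith⟩
  · refine ⟨n, m, ?_⟩
    have h1 : 0 < (m * n) * (P * C - m * n) := by
      rw [hkey]
      by_contra hcon
      push Not at hcon
      have h2 : 0 ≤ (m * n) * (z ^ 2 * (A * B)) := by linarith
      have h3 := mul_pos h hPABC
      have h4 := mul_nonneg h2 (sq_nonneg (P * C))
      nlinarith
    nlinarith

theorem le_sq_of_pos {A B C x y z : ℝ} (hABC : 0 < A * B * C)
    (hP : 0 < x * y * C + x * z * B + y * z * A) (s t : ℝ) :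
    4 * (x * y * C + x * z * B + y * z * A) * (s * t * C) ≤
      (s * (y * C + z * B) + t * (x * C + z * A)) ^ 2 := by
  set P := x * y * C + x * z * B + y * z * A with hPdef
  set m := y * C + z * B with hm
  set n := x * C + z * A with hn
  have hC : C ≠ 0 := by rintro rfl; simp at hABC
  have hkey : P * C - m * n = -(z ^ 2 * (A * B)) := by rw [hPdef, hm, hn]; ring
  have hdisc : P * C * (P * C - m * n) ≤ 0 := by
    rw [hkey]
    have := mul_nonneg (mul_nonneg (sq_nonneg z) hABC.le) hP.le
    linarith
  by_cases hm0 : m = 0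
  · rw [hm0] at hdisc
    have : 0 < (P * C) ^ 2 := sq_pos_of_ne_zero (mul_ne_zero hP.ne' hC)
    nlinarith
  · have hm2 := sq_pos_of_ne_zero hm0
    have h1 : 0 ≤ m ^ 2 * ((s * m + t * n) ^ 2 - 4 * P * (s * t * C)) := by
      have h2 : m ^ 2 * ((s * m + t * n) ^ 2 - 4 * P * (s * t * C)) =
          (m ^ 2 * s + (m * n - 2 * (P * C)) * t) ^ 2 +
            t ^ 2 * (-4 * (P * C * (P * C - m * n))) := by ring
      rw [h2]
      have := mul_nonneg (sq_nonneg t) (by linarith : 0 ≤ -4 * (P * C * (P * C - m * n)))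
      have := sq_nonneg (m ^ 2 * s + (m * n - 2 * (P * C)) * t)
      linarith
    have := nonneg_of_mul_nonneg_right h1 hm2
    linarith

/-- For a nondegenerate conic through the basis `a, b, c`, normalized to have positive
discriminant, the points outside the conic are those where the form is negative. -/
theorem outsideConic_iff_neg (q : QuadraticForm ℝ (Fin 3 → ℝ)) {a b c : Fin 3 → ℝ}
    (ha : q a = 0) (hb : q b = 0) (hc : q c = 0)
    (hABC : 0 < polar q b c * polar q a c * polar q a b) (P : RP2)
    {ε : ℝ} (habc : bracket ε a b c ≠ 0) (habP : bracket ε a b P.rep ≠ 0)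
    (hqP : q P.rep ≠ 0) : OutsideConic q P ↔ q P.rep < 0 := by
  obtain ⟨x, y, z, hz, hxyz⟩ : ∃ x y z : ℝ, z ≠ 0 ∧ P.rep = x • a + y • b + z • c := by
    refine ⟨bracket ε P.rep b c / bracket ε a b c, bracket ε a P.rep c / bracket ε a b c,
      bracket ε a b P.rep / bracket ε a b c, div_ne_zero habP habc, ?_⟩
    exact eq_combination_of_bracket_ne_zero habc P.rep
  have hq : q P.rep = x * y * polar q a b + x * z * polar q a c + y * z * polar q b c := by
    rw [hxyz, map_triple_combination q x y z ha hb hc]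
  have hpol (s t : ℝ) : polar q P.rep (s • a + t • b) =
      s * (y * polar q a b + z * polar q a c) + t * (x * polar q a b + z * polar q b c) := by
    rw [hxyz, polar_combination q x y z s t ha hb]
  have hqw (s t : ℝ) : q (s • a + t • b) = s * t * polar q a b := by
    rw [map_pair_combination, ha, hb]; ring
  constructor
  · rintro ⟨L, ⟨W, hW, rfl⟩, hP, hL⟩
    by_contra hneg
    have hpos : 0 < q P.rep := lt_of_le_of_ne (not_lt.1 hneg) hqP.symm
    have hPW : P.rep ∈ W := hP
    obtain ⟨v, hvW, hv⟩ : ∃ v ∈ W, v ∉ Submodule.span ℝ {P.rep} := by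
      by_contra hcon
      push Not at hcon
      have h1 := Submodule.finrank_mono (show W ≤ Submodule.span ℝ {P.rep} from hcon)
      rw [hW, finrank_span_singleton P.rep_nonzero] at h1
      omega
    set δ := bracket ε a b P.rep with hδ
    set w := δ • v - bracket ε a b v • P.rep with hw
    have hwW : w ∈ W := W.sub_mem (W.smul_mem _ hvW) (W.smul_mem _ hPW)
    obtain ⟨s, t, hst⟩ : ∃ s t : ℝ, w = s • a + t • b := by
      refine ⟨bracket ε w b c / bracket ε a b c, bracket ε a w c / bracket ε a b c, ?_⟩
      have hw0 : bracket ε a b w = 0 := by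
        rw [hw, map_sub, map_smul, map_smul, ← hδ, smul_eq_mul, smul_eq_mul]; ring
      simpa only [hw0, zero_div, zero_smul, add_zero] using
        eq_combination_of_bracket_ne_zero habc w
    obtain ⟨r, hr⟩ := exists_map_smul_add_eq_zero q (p := P.rep) (w := w) hqP (by
      rw [hst, hpol, hqw, hq]
      rw [hq] at hpos
      exact le_sq_of_pos hABC hpos s t)
    set u := r • P.rep + w with hu
    have hu0 : u ≠ 0 := by
      intro h0
      refine hv (Submodule.mem_span_singleton.2 ⟨δ⁻¹ * (bracket ε a b v - r), ?_⟩)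
      have : δ • v = (bracket ε a b v - r) • P.rep := by
        have h1 : r • P.rep + (δ • v - bracket ε a b v • P.rep) = 0 := by rw [← hw, ← hu, h0]
        rw [sub_smul, ← sub_eq_zero, ← h1]; abel
      rw [mul_smul, ← this, smul_smul, inv_mul_cancel₀ habP, one_smul]
    have huW : u ∈ W := W.add_mem (W.smul_mem _ hPW) hwW
    obtain ⟨k, hk⟩ := exists_smul_eq_mk_rep ℝ u hu0
    have hmem : (Projectivization.mk ℝ u hu0) ∈ {p : RP2 | p.rep ∈ W} ∩ ConicSet q := by
      refine ⟨?_, ?_⟩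
      · change (Projectivization.mk ℝ u hu0).rep ∈ W
        rw [← hk]; exact W.smul_mem _ huW
      · change q (Projectivization.mk ℝ u hu0).rep = 0
        rw [← hk, Units.smul_def, QuadraticMap.map_smul, hr, smul_zero]
    rw [hL] at hmem
    exact hmem
  · intro hneg
    rw [hq] at hneg
    obtain ⟨s, t, hst⟩ := exists_sq_lt_of_neg hABC hz hneg
    refine outsideConic_of_sq_polar_lt q P (w := s • a + t • b) ?_
    rw [hpol, hqw, hq]
    exact hst

end ConicCriterion

section PositiveFrame

/-- `a, b, c` are distinct and occur in this cyclic order in `Fin 7`. -/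
abbrev CyclicOrder (a b c : Fin 7) : Prop :=
  (a < b ∧ b < c) ∨ (b < c ∧ c < a) ∨ (c < a ∧ a < b)

/-- The vectors `v k` represent the points `f k`, and cyclically ordered triples are positively
oriented with respect to the volume form scaled by `ε`. -/
structure PositiveFrame (f : Fin 7 → RP2) (ε : ℝ) (v : Fin 7 → Fin 3 → ℝ) : Prop where
  rep : ∀ k, ∃ t : ℝ, t ≠ 0 ∧ (f k).rep = t • v k
  pos : ∀ a b c, CyclicOrder a b c → 0 < bracket ε (v a) (v b) (v c)

theorem PositiveFrame.bracket_ne_zero {f : Fin 7 → RP2} {ε : ℝ} {v : Fin 7 → Fin 3 → ℝ}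
    (hv : PositiveFrame f ε v) {a b c : Fin 7} (hab : a ≠ b) (hac : a ≠ c) (hbc : b ≠ c) :
    bracket ε (v a) (v b) (v c) ≠ 0 := by
  have h : CyclicOrder a b c ∨ CyclicOrder a c b := by
    revert a b c; decide
  rcases h with h | h
  · exact (hv.pos _ _ _ h).ne'
  · have := hv.pos _ _ _ h
    rw [bracket_swap_right] at this
    linarith

theorem PositiveFrame.map_rep_eq_zero_iff {f : Fin 7 → RP2} {ε : ℝ} {v : Fin 7 → Fin 3 → ℝ}
    (hv : PositiveFrame f ε v) (q : QuadraticForm ℝ (Fin 3 → ℝ)) (k : Fin 7) :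
    q (f k).rep = 0 ↔ q (v k) = 0 := by
  obtain ⟨t, ht, hk⟩ := hv.rep k
  rw [hk, QuadraticMap.map_smul]
  simp [ht]

open Fin.CommRing in
/-- A cyclic sequence of seven vectors for which every edge is positive with respect to all
other vectors is totally positive. -/
theorem bracket_pos_of_edges {ε : ℝ} {v : Fin 7 → Fin 3 → ℝ}
    (hedge : ∀ i j, j ≠ i → j ≠ i + 1 → 0 < bracket ε (v i) (v (i + 1)) (v j))
    {a b c : Fin 7} (h : CyclicOrder a b c) : 0 < bracket ε (v a) (v b) (v c) := by
  have hne : ∀ k : ℕ, 1 ≤ k → k ≤ 6 → ∀ a : Fin 7, a ≠ a + (k : Fin 7) := by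
    intro k h1 h2; interval_cases k <;> decide
  have hne' : ∀ k : ℕ, 2 ≤ k → k ≤ 6 → ∀ a : Fin 7, a + (k : Fin 7) ≠ a + 1 := by
    intro k h1 h2; interval_cases k <;> decide
  have key : ∀ k : ℕ, 1 ≤ k → ∀ l : ℕ, k + 1 ≤ l → l ≤ 6 →
      0 < bracket ε (v a) (v (a + (k : Fin 7))) (v (a + (l : Fin 7))) := by
    intro k hk l hl
    induction l, hl using Nat.le_induction with
    | base =>
      intro h6
      rw [← bracket_rotate, Nat.cast_succ, ← add_assoc]
      refine hedge _ _ (hne k hk (by omega) a) ?_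
      have := hne (k + 1) (by omega) h6 a
      rwa [Nat.cast_succ, ← add_assoc] at this
    | succ l hl ih =>
      intro h6
      have h1 (m : ℕ) (hm : 2 ≤ m) (hm6 : m ≤ 6) :
          0 < bracket ε (v a) (v (a + 1)) (v (a + (m : Fin 7))) :=
        hedge _ _ (hne m (by omega) hm6 a).symm (hne' m hm hm6 a)
      rcases hk.eq_or_lt with rfl | hk1
      · simpa using h1 (l + 1) (by omega) h6
      · have h2 : 0 < bracket ε (v a) (v (a + (l : Fin 7))) (v (a + ((l + 1 : ℕ) : Fin 7))) := by
          rw [← bracket_rotate, Nat.cast_succ, ← add_assoc]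
          refine hedge _ _ (hne l (by omega) (by omega) a) ?_
          have := hne (l + 1) (by omega) h6 a
          rwa [Nat.cast_succ, ← add_assoc] at this
        have h3 := bracket_plucker ε (v a) (v (a + 1)) (v (a + (k : Fin 7))) (v (a + (l : Fin 7)))
          (v (a + ((l + 1 : ℕ) : Fin 7)))
        have h4 := h1 k hk1 (by omega)
        have h5 := h1 l (by omega) (by omega)
        have h7 := mul_pos h4 h2
        have h8 := mul_pos (h1 (l + 1) (by omega) h6) (ih (by omega))
        refine pos_of_mul_pos_right (a := bracket ε (v a) (v (a + 1)) (v (a + (l : Fin 7)))) ?_ h5.le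
        linarith
  have hdiff : ∀ a b c : Fin 7, CyclicOrder a b c → 0 < b - a ∧ b - a < c - a := by decide
  obtain ⟨h1, h2⟩ := hdiff a b c h
  have := key (b - a).val (by omega) (c - a).val (by omega) (by omega)
  simpa using this

open Fin.CommRing in
theorem exists_positiveFrame {f : Fin 7 → RP2} (hf : SimpleCfg f) (hconv : ConsecConvexPos f) :
    ∃ ε v, PositiveFrame f ε v := by
  obtain ⟨φ, ⟨-, hφ, -⟩, hψ⟩ := hconv
  set v : Fin 7 → Fin 3 → ℝ := fun k => chart φ (f k) with hv
  have hrep (k : Fin 7) : (f k).rep = φ (f k).rep • v k := by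
    rw [hv]; simp only [chart]; rw [smul_smul, mul_inv_cancel₀ (hφ k), one_smul]
  have hφv (k : Fin 7) : φ (v k) = 1 := by
    rw [hv]; simp only [chart, map_smul, smul_eq_mul]; exact inv_mul_cancel₀ (hφ k)
  have hD {a b c : Fin 7} (hab : a ≠ b) (hac : a ≠ c) (hbc : b ≠ c) :
      bracket 1 (v a) (v b) (v c) ≠ 0 := by
    have h := bracket_ne_zero one_ne_zero (not_not.1 (hf.2 a b c hab hac hbc))
    intro h0
    apply h
    rw [hrep a, hrep b, hrep c]
    have : ∀ r s t : ℝ, bracket 1 (r • v a) (s • v b) (t • v c) =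
        r * s * t * bracket 1 (v a) (v b) (v c) := by
      intro r s t
      simp only [bracket_apply, Pi.smul_apply, smul_eq_mul]; ring
    rw [this, h0, mul_zero]
  have hL (i : Fin 7) : ∃ M : (Fin 3 → ℝ) →ₗ[ℝ] ℝ, M (v i) = 0 ∧ M (v (i + 1)) = 0 ∧
      ∀ j, j ≠ i → j ≠ i + 1 → 0 < M (v j) := by
    obtain ⟨ψ, h1, h2⟩ := hψ i
    refine ⟨ψ (v i) • φ - ψ, ?_, ?_, fun j hj hj' => ?_⟩
    · simp [hφv]
    · simp only [LinearMap.sub_apply, LinearMap.smul_apply, hφv, smul_eq_mul, mul_one]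
      exact sub_eq_zero.2 h1
    · simp only [LinearMap.sub_apply, LinearMap.smul_apply, hφv, smul_eq_mul, mul_one]
      exact sub_pos.2 (h2 j hj hj')
  have hsame (i j k : Fin 7) (hj : j ≠ i) (hj' : j ≠ i + 1) (hk : k ≠ i) (hk' : k ≠ i + 1) :
      0 < bracket 1 (v i) (v (i + 1)) (v j) * bracket 1 (v i) (v (i + 1)) (v k) := by
    obtain ⟨M, h1, h2, hM⟩ := hL i
    have hi : i ≠ i + 1 := by clear * -; revert i; decide
    have hDj := sq_pos_of_ne_zero (hD hi hj.symm hj'.symm)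
    have h3 := map_mul_bracket_comm 1 M h1 h2 (v j) (v k)
    have h4 := mul_pos (hM k hk hk') hDj
    refine pos_of_mul_pos_right (a := M (v j)) ?_ (hM j hj hj').le
    have h5 : M (v j) * (bracket 1 (v i) (v (i + 1)) (v j) *
        bracket 1 (v i) (v (i + 1)) (v k)) =
        M (v k) * bracket 1 (v i) (v (i + 1)) (v j) ^ 2 := by
      linear_combination bracket 1 (v i) (v (i + 1)) (v j) * h3
    rw [h5]; exact h4
  set ε := bracket 1 (v 0) (v 1) (v 2) with hε
  have hscale (a b c : Fin 7) :
      bracket ε (v a) (v b) (v c) = ε * bracket 1 (v a) (v b) (v c) := by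
    rw [bracket_eq_mul_det, bracket_eq_mul_det 1, one_mul]
  have hedge : ∀ n : ℕ, ∀ j : Fin 7, j ≠ (n : Fin 7) → j ≠ (n : Fin 7) + 1 →
      0 < ε * bracket 1 (v (n : Fin 7)) (v ((n : Fin 7) + 1)) (v j) := by
    intro n
    induction n with
    | zero =>
      intro j h1 h2
      exact hsame 0 2 j (by decide) (by decide) h1 h2
    | succ n ih =>
      intro j h1 h2
      rw [Nat.cast_succ] at h1 h2 ⊢
      generalize (n : Fin 7) = i at *
      have hi : i + 1 + 1 ≠ i ∧ i + 1 + 1 ≠ i + 1 ∧ i ≠ i + 1 := by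
        clear * -; revert i; decide
      have h3 := ih (i + 1 + 1) hi.1 hi.2.1
      rw [← bracket_rotate] at h3
      have h4 := hsame (i + 1) i j hi.2.2 hi.1.symm h1 h2
      have h5 := mul_pos h3 h4
      have h6 := sq_pos_of_ne_zero (hD hi.2.1.symm hi.2.2.symm hi.1)
      refine pos_of_mul_pos_right (a := bracket 1 (v (i + 1)) (v (i + 1 + 1)) (v i) ^ 2) ?_ h6.le
      linarith
  refine ⟨ε, v, fun k => ⟨_, hφ k, hrep k⟩, fun a b c habc =>
    bracket_pos_of_edges (fun i j h1 h2 => ?_) habc⟩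
  have := hedge i.val j (by simpa using h1) (by simpa using h2)
  rw [hscale]
  simpa using this

end PositiveFrame

section ConicRelation

/-- The six quadratic monomials of a vector in `ℝ³`. -/
def veronese (x : Fin 3 → ℝ) : Fin 6 → ℝ :=
  ![x 0 * x 0, x 1 * x 1, x 2 * x 2, x 0 * x 1, x 0 * x 2, x 1 * x 2]

theorem exists_eq_sum_veronese (q : QuadraticForm ℝ (Fin 3 → ℝ)) :
    ∃ m : Fin 6 → ℝ, ∀ x, q x = ∑ l, m l * veronese x l := by
  refine ⟨![q (Pi.single 0 1), q (Pi.single 1 1), q (Pi.single 2 1),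
    QuadraticMap.polar q (Pi.single 0 1) (Pi.single 1 1),
    QuadraticMap.polar q (Pi.single 0 1) (Pi.single 2 1),
    QuadraticMap.polar q (Pi.single 1 1) (Pi.single 2 1)], fun x => ?_⟩
  have hx : x = (x 0 • Pi.single 0 1 + x 1 • Pi.single 1 1) + x 2 • Pi.single 2 1 := by
    ext k; fin_cases k <;> simp
  conv_lhs => rw [hx]
  rw [QuadraticMap.map_add q, QuadraticMap.map_smul, map_pair_combination,
    QuadraticMap.polar_smul_right, QuadraticMap.polar_add_left, QuadraticMap.polar_smul_left,
    QuadraticMap.polar_smul_left]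
  simp [Fin.sum_univ_six, veronese]
  ring

theorem exists_conic_coefficients (m : Fin 6 → ℝ) :
    ∃ q : QuadraticForm ℝ (Fin 3 → ℝ), ∀ x, q x = ∑ l, m l * veronese x l := by
  let p (k : Fin 3) : (Fin 3 → ℝ) →ₗ[ℝ] ℝ := LinearMap.proj k
  refine ⟨m 0 • QuadraticMap.linMulLin (p 0) (p 0) + m 1 • QuadraticMap.linMulLin (p 1) (p 1) +
    m 2 • QuadraticMap.linMulLin (p 2) (p 2) + m 3 • QuadraticMap.linMulLin (p 0) (p 1) +
    m 4 • QuadraticMap.linMulLin (p 0) (p 2) + m 5 • QuadraticMap.linMulLin (p 1) (p 2),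
    fun x => ?_⟩
  simp [Fin.sum_univ_six, veronese, p]

theorem eq_zero_of_sum_veronese_eq_zero {m : Fin 6 → ℝ}
    (h : ∀ x, ∑ l, m l * veronese x l = 0) : m = 0 := by
  have h0 := h ![1, 0, 0]
  have h1 := h ![0, 1, 0]
  have h2 := h ![0, 0, 1]
  have h3 := h ![1, 1, 0]
  have h4 := h ![1, 0, 1]
  have h5 := h ![0, 1, 1]
  simp [Fin.sum_univ_six, veronese] at h0 h1 h2 h3 h4 h5
  ext l
  fin_cases l <;> simp <;> linarith

/-- Seven points of the plane satisfy a linear relation under the Veronese embedding; its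
coefficients are nonzero if no six of the points are coconic. -/
theorem exists_conic_relation {v : Fin 7 → Fin 3 → ℝ}
    (hv : ∀ (j : Fin 7) (q : QuadraticForm ℝ (Fin 3 → ℝ)),
      (∀ k, k ≠ j → q (v k) = 0) → q = 0) :
    ∃ c : Fin 7 → ℝ, (∀ j, c j ≠ 0) ∧
      ∀ q : QuadraticForm ℝ (Fin 3 → ℝ), ∑ k, c k * q (v k) = 0 := by
  have hdep : ¬ LinearIndependent ℝ fun k => veronese (v k) := by
    intro h
    have := h.fintype_card_le_finrank
    simp at this
  obtain ⟨c, hc, k₀, hk₀⟩ := Fintype.not_linearIndependent_iff.1 hdep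
  have hc' (l : Fin 6) : ∑ k, c k * veronese (v k) l = 0 := by
    have := congrFun hc l
    simpa using this
  refine ⟨c, fun j hj => ?_, fun q => ?_⟩
  · have hdet : (Matrix.of fun l : Fin 6 => veronese (v (j.succAbove l))).det = 0 := by
      rw [← Matrix.exists_vecMul_eq_zero_iff]
      refine ⟨fun l => c (j.succAbove l), fun h => ?_, ?_⟩
      · rcases eq_or_ne k₀ j with rfl | hne
        · exact hk₀ hj
        · obtain ⟨l, rfl⟩ := Fin.exists_succAbove_eq hne
          exact hk₀ (congrFun h l)
      · ext l
        have := hc' l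
        rw [Fin.sum_univ_succAbove _ j, hj, zero_mul, zero_add] at this
        simpa [Matrix.vecMul, dotProduct] using this
    obtain ⟨m, hm, hm0⟩ := Matrix.exists_mulVec_eq_zero_iff.2 hdet
    obtain ⟨q, hq⟩ := exists_conic_coefficients m
    apply hm
    have hq0 : q = 0 := by
      refine hv j q fun k hk => ?_
      obtain ⟨l, rfl⟩ := Fin.exists_succAbove_eq hk
      have := congrFun hm0 l
      rw [hq]
      simpa [Matrix.mulVec, dotProduct, mul_comm] using this
    exact eq_zero_of_sum_veronese_eq_zero fun x => by rw [← hq, hq0]; rfl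
  · obtain ⟨m, hm⟩ := exists_eq_sum_veronese q
    simp only [hm, Finset.mul_sum]
    rw [Finset.sum_comm]
    refine Finset.sum_eq_zero fun l _ => ?_
    have : ∑ k, c k * (m l * veronese (v k) l) = m l * ∑ k, c k * veronese (v k) l := by
      rw [Finset.mul_sum]; exact Finset.sum_congr rfl fun k _ => by ring
    rw [this, hc', mul_zero]

end ConicRelation

section PentagonConic

/-- The conic through five points, normalized to have positive discriminant when the points are
the vertices of a positively oriented pentagon. -/
def pentagonConic (ε : ℝ) (p : Fin 5 → Fin 3 → ℝ) : QuadraticForm ℝ (Fin 3 → ℝ) :=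
  (bracket ε (p 0) (p 2) (p 4) * bracket ε (p 1) (p 3) (p 4)) •
      QuadraticMap.linMulLin (bracket ε (p 0) (p 1)) (bracket ε (p 2) (p 3)) -
    (bracket ε (p 0) (p 1) (p 4) * bracket ε (p 2) (p 3) (p 4)) •
      QuadraticMap.linMulLin (bracket ε (p 0) (p 2)) (bracket ε (p 1) (p 3))

theorem pentagonConic_apply (ε : ℝ) (p : Fin 5 → Fin 3 → ℝ) (y : Fin 3 → ℝ) :
    pentagonConic ε p y =
      bracket ε (p 0) (p 2) (p 4) * bracket ε (p 1) (p 3) (p 4) *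
          (bracket ε (p 0) (p 1) y * bracket ε (p 2) (p 3) y) -
        bracket ε (p 0) (p 1) (p 4) * bracket ε (p 2) (p 3) (p 4) *
          (bracket ε (p 0) (p 2) y * bracket ε (p 1) (p 3) y) := by
  simp [pentagonConic]

theorem pentagonConic_apply_self (ε : ℝ) (p : Fin 5 → Fin 3 → ℝ) (k : Fin 5) :
    pentagonConic ε p (p k) = 0 := by
  rw [pentagonConic_apply]
  fin_cases k <;> simp
  ring

theorem pentagonConic_swap (ε : ℝ) (a b c d e y : Fin 3 → ℝ) :
    pentagonConic ε ![a, b, c, d, e] y = -pentagonConic ε ![a, b, c, d, y] e := by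
  simp only [pentagonConic_apply, Matrix.cons_val]
  ring

theorem polar_pentagonConic_zero_one (ε : ℝ) (p : Fin 5 → Fin 3 → ℝ) :
    QuadraticMap.polar (pentagonConic ε p) (p 0) (p 1) =
      bracket ε (p 0) (p 1) (p 2) * bracket ε (p 0) (p 1) (p 3) *
        (bracket ε (p 0) (p 1) (p 4) * bracket ε (p 2) (p 3) (p 4)) := by
  simp only [QuadraticMap.polar, pentagonConic_apply_self]
  simp only [pentagonConic_apply, map_add, bracket_self_left, bracket_self_right]
  rw [bracket_swap_right ε (p 0) (p 1) (p 2), ← bracket_rotate ε (p 0) (p 1) (p 3)]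
  ring

theorem polar_pentagonConic_zero_two (ε : ℝ) (p : Fin 5 → Fin 3 → ℝ) :
    QuadraticMap.polar (pentagonConic ε p) (p 0) (p 2) =
      bracket ε (p 0) (p 1) (p 2) * bracket ε (p 0) (p 2) (p 3) *
        (bracket ε (p 0) (p 2) (p 4) * bracket ε (p 1) (p 3) (p 4)) := by
  simp only [QuadraticMap.polar, pentagonConic_apply_self]
  simp only [pentagonConic_apply, map_add, bracket_self_left, bracket_self_right]
  rw [← bracket_rotate ε (p 0) (p 2) (p 3)]
  ring

theorem polar_pentagonConic_one_two (ε : ℝ) (p : Fin 5 → Fin 3 → ℝ) :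
    QuadraticMap.polar (pentagonConic ε p) (p 1) (p 2) =
      bracket ε (p 0) (p 1) (p 2) * bracket ε (p 1) (p 2) (p 3) *
        (bracket ε (p 0) (p 3) (p 4) * bracket ε (p 1) (p 2) (p 4)) := by
  simp only [QuadraticMap.polar, pentagonConic_apply_self]
  simp only [pentagonConic_apply, bracket_apply, Pi.add_apply]
  ring

end PentagonConic

section DominanceIndex

theorem TypicalCfg.eq_zero_of_map_rep_eq_zero {f : Fin 7 → RP2} (hf : TypicalCfg f) (j : Fin 7)
    {q : QuadraticForm ℝ (Fin 3 → ℝ)} (hq : ∀ k, k ≠ j → q (f k).rep = 0) : q = 0 := by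
  by_contra h
  refine hf.2 j.succAbove Fin.succAbove_right_injective ⟨q, h, ?_⟩
  rintro - ⟨l, rfl⟩
  exact hq _ (Fin.succAbove_ne j l)

/-- `l` lists, in cyclic order, all indices other than `i` and `j`. -/
structure IsPentagon (i j : Fin 7) (l : Fin 5 → Fin 7) : Prop where
  ne : i ≠ j
  cyclic : ∀ x y z, x < y → y < z → CyclicOrder (l x) (l y) (l z)
  left_ne : ∀ x, l x ≠ i
  right_ne : ∀ x, l x ≠ j
  exhaust : ∀ k, k ≠ i → k ≠ j → ∃ x, l x = k

theorem IsPentagon.symm {i j : Fin 7} {l : Fin 5 → Fin 7} (h : IsPentagon i j l) :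
    IsPentagon j i l :=
  ⟨h.ne.symm, h.cyclic, h.right_ne, h.left_ne, fun k hk hk' => h.exhaust k hk' hk⟩

variable {f : Fin 7 → RP2} {ε : ℝ} {v : Fin 7 → Fin 3 → ℝ} {i j : Fin 7} {l : Fin 5 → Fin 7}

theorem IsPentagon.conic_eq_zero (hl : IsPentagon i j l) {k : Fin 7} (hki : k ≠ i)
    (hkj : k ≠ j) : pentagonConic ε (v ∘ l) (v k) = 0 := by
  obtain ⟨x, rfl⟩ := hl.exhaust k hki hkj
  exact pentagonConic_apply_self ε (v ∘ l) x

theorem IsPentagon.bracket_pos (hl : IsPentagon i j l) (hv : PositiveFrame f ε v)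
    {x y z : Fin 5} (hxy : x < y) (hyz : y < z) :
    0 < bracket ε ((v ∘ l) x) ((v ∘ l) y) ((v ∘ l) z) :=
  hv.pos _ _ _ (hl.cyclic x y z hxy hyz)

theorem IsPentagon.polar_mul_pos (hl : IsPentagon i j l) (hv : PositiveFrame f ε v) :
    0 < QuadraticMap.polar (pentagonConic ε (v ∘ l)) ((v ∘ l) 1) ((v ∘ l) 2) *
      QuadraticMap.polar (pentagonConic ε (v ∘ l)) ((v ∘ l) 0) ((v ∘ l) 2) *
      QuadraticMap.polar (pentagonConic ε (v ∘ l)) ((v ∘ l) 0) ((v ∘ l) 1) := by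
  rw [polar_pentagonConic_one_two, polar_pentagonConic_zero_two, polar_pentagonConic_zero_one]
  have h {x y z : Fin 5} (hxy : x < y) (hyz : y < z) := hl.bracket_pos hv hxy hyz
  have h012 := h (x := 0) (y := 1) (z := 2) (by decide) (by decide)
  have h013 := h (x := 0) (y := 1) (z := 3) (by decide) (by decide)
  have h014 := h (x := 0) (y := 1) (z := 4) (by decide) (by decide)
  have h023 := h (x := 0) (y := 2) (z := 3) (by decide) (by decide)
  have h024 := h (x := 0) (y := 2) (z := 4) (by decide) (by decide)
  have h034 := h (x := 0) (y := 3) (z := 4) (by decide) (by decide)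
  have h123 := h (x := 1) (y := 2) (z := 3) (by decide) (by decide)
  have h124 := h (x := 1) (y := 2) (z := 4) (by decide) (by decide)
  have h134 := h (x := 1) (y := 3) (z := 4) (by decide) (by decide)
  have h234 := h (x := 2) (y := 3) (z := 4) (by decide) (by decide)
  positivity

theorem IsPentagon.conic_ne_zero (hl : IsPentagon i j l) (hf : TypicalCfg f)
    (hv : PositiveFrame f ε v) : pentagonConic ε (v ∘ l) (v i) ≠ 0 := by
  intro h0
  have hq : pentagonConic ε (v ∘ l) = 0 := by
    refine hf.eq_zero_of_map_rep_eq_zero j fun k hk => ?_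
    rw [hv.map_rep_eq_zero_iff]
    rcases eq_or_ne k i with rfl | hki
    · exact h0
    · exact hl.conic_eq_zero hki hk
  have := hl.polar_mul_pos hv
  rw [hq] at this
  simp [QuadraticMap.polar] at this

theorem outsideConic_smul_iff {r : ℝ} (hr : r ≠ 0) (q : QuadraticForm ℝ (Fin 3 → ℝ)) (P : RP2) :
    OutsideConic (r • q) P ↔ OutsideConic q P := by
  have : ConicSet (r • q) = ConicSet q := by
    ext p
    change r • q p.rep = 0 ↔ q p.rep = 0
    simp [hr]
  simp only [OutsideConic, this]

theorem IsPentagon.outAll_iff (hl : IsPentagon i j l) (hf : TypicalCfg f)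
    (hv : PositiveFrame f ε v) : OutAll f i j ↔ pentagonConic ε (v ∘ l) (v i) < 0 := by
  have hne := hl.conic_ne_zero hf hv
  set Q := pentagonConic ε (v ∘ l) with hQ
  have hQ0 : Q ≠ 0 := by
    intro h; rw [h] at hne; exact hne rfl
  have hQi : Q (f i).rep ≠ 0 := by rwa [Ne, hv.map_rep_eq_zero_iff]
  have hQk (k : Fin 7) (hki : k ≠ i) (hkj : k ≠ j) : Q (f k).rep = 0 := by
    rw [hv.map_rep_eq_zero_iff]; exact hl.conic_eq_zero hki hkj
  have hout : OutAll f i j ↔ OutsideConic Q (f i) := by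
    refine ⟨fun h => h Q hQ0 hQk, fun h q hq hqk => ?_⟩
    have hr : q = (q (f i).rep / Q (f i).rep) • Q := by
      rw [← sub_eq_zero]
      refine hf.eq_zero_of_map_rep_eq_zero j fun k hk => ?_
      rw [sub_apply, smul_apply, smul_eq_mul]
      rcases eq_or_ne k i with rfl | hki
      · field_simp; ring
      · rw [hqk k hki hk, hQk k hki hk]; ring
    have hr0 : q (f i).rep / Q (f i).rep ≠ 0 := by
      intro h0; rw [h0, zero_smul] at hr; exact hq hr
    rw [hr, outsideConic_smul_iff hr0]
    exact h
  obtain ⟨t, ht, hti⟩ := hv.rep i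
  have hb : bracket ε ((v ∘ l) 0) ((v ∘ l) 1) (f i).rep ≠ 0 := by
    rw [hti, map_smul, smul_eq_mul]
    refine mul_ne_zero ht (hv.bracket_ne_zero ?_ (hl.left_ne 0) (hl.left_ne 1))
    have h01 := hl.cyclic 0 1 2 (by decide) (by decide)
    rintro h
    rw [h] at h01
    revert h01
    generalize l 1 = a, l 2 = b
    revert a b; decide
  rw [hout, outsideConic_iff_neg Q (pentagonConic_apply_self ε (v ∘ l) 0)
    (pentagonConic_apply_self ε (v ∘ l) 1) (pentagonConic_apply_self ε (v ∘ l) 2)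
    (hl.polar_mul_pos hv) (f i) (hl.bracket_pos hv (by decide) (by decide)).ne' hb hQi, hti,
    QuadraticMap.map_smul, smul_eq_mul]
  have ht2 : 0 < t * t := mul_self_pos.2 ht
  exact ⟨fun h => neg_of_mul_neg_right h ht2.le, fun h => mul_neg_of_pos_of_neg ht2 h⟩

variable {c : Fin 7 → ℝ}

theorem IsPentagon.relation (hl : IsPentagon i j l)
    (hrel : ∀ q : QuadraticForm ℝ (Fin 3 → ℝ), ∑ k, c k * q (v k) = 0) :
    c i * pentagonConic ε (v ∘ l) (v i) + c j * pentagonConic ε (v ∘ l) (v j) = 0 := by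
  rw [← hrel (pentagonConic ε (v ∘ l)), eq_comm]
  refine Fintype.sum_eq_add i j hl.ne fun k hk => ?_
  rw [hl.conic_eq_zero hk.1 hk.2, mul_zero]

theorem IsPentagon.outAll_comm (hl : IsPentagon i j l) (hf : TypicalCfg f)
    (hv : PositiveFrame f ε v)
    (hrel : ∀ q : QuadraticForm ℝ (Fin 3 → ℝ), ∑ k, c k * q (v k) = 0) (hc : c i * c j < 0) :
    OutAll f i j ↔ OutAll f j i := by
  rw [hl.outAll_iff hf hv, hl.symm.outAll_iff hf hv]
  have h := hl.relation (ε := ε) hrel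
  set X := pentagonConic ε (v ∘ l) (v i)
  set Y := pentagonConic ε (v ∘ l) (v j)
  have hci := sq_pos_of_ne_zero (left_ne_zero_of_mul hc.ne)
  have h' : c i ^ 2 * X = -(c i * c j) * Y := by linear_combination c i * h
  constructor
  · intro hX
    have := mul_neg_of_pos_of_neg hci hX
    rw [h'] at this
    exact neg_of_mul_neg_right this (by linarith)
  · intro hY
    have := mul_neg_of_pos_of_neg (neg_pos.2 hc) hY
    rw [← h'] at this
    exact neg_of_mul_neg_right this hci.le

/-- Exchanging the omitted point with a neighbour of opposite sign in the conic relation does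
not change the position of the `i`-th point. -/
theorem outAll_iff_outAll_of_neg {a b d e k : Fin 7} (hj : IsPentagon i j ![a, b, d, e, k])
    (hk : IsPentagon i k ![a, b, d, e, j]) (hf : TypicalCfg f) (hv : PositiveFrame f ε v)
    (hrel : ∀ q : QuadraticForm ℝ (Fin 3 → ℝ), ∑ k, c k * q (v k) = 0) (hci : c i ≠ 0)
    (hc : c j * c k < 0) : OutAll f i j ↔ OutAll f i k := by
  rw [hj.outAll_iff hf hv, hk.outAll_iff hf hv]
  have h1 := hj.relation (ε := ε) hrel
  have h2 := hk.relation (ε := ε) hrel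
  have h3 : pentagonConic ε (v ∘ ![a, b, d, e, k]) (v j) =
      -pentagonConic ε (v ∘ ![a, b, d, e, j]) (v k) := by
    have hcomp (x : Fin 7) : v ∘ ![a, b, d, e, x] = ![v a, v b, v d, v e, v x] := by
      ext y; fin_cases y <;> rfl
    rw [hcomp, hcomp, pentagonConic_swap]
  have hX := hj.conic_ne_zero hf hv
  rw [h3] at h1
  set X := pentagonConic ε (v ∘ ![a, b, d, e, k]) (v i)
  set Y := pentagonConic ε (v ∘ ![a, b, d, e, j]) (v i)
  set Z := pentagonConic ε (v ∘ ![a, b, d, e, j]) (v k)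
  have hZ : Z ≠ 0 := by
    intro hZ
    rw [hZ] at h1
    have : c i * X = 0 := by linarith
    exact mul_ne_zero hci hX this
  have hXY : 0 < X * Y := by
    have h4 : c i ^ 2 * (X * Y) = -(c j * c k) * Z ^ 2 := by
      linear_combination c i * Y * h1 + c j * Z * h2
    have h5 := mul_pos (neg_pos.2 hc) (sq_pos_of_ne_zero hZ)
    rw [← h4] at h5
    exact pos_of_mul_pos_right h5 (sq_nonneg _)
  constructor
  · intro h; exact neg_of_mul_pos_right hXY h.le
  · intro h; exact neg_of_mul_pos_left hXY h.le

/-- The conic relation evaluated on a pair of lines through four of the points. -/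
theorem relation_of_lines {a b d e x y z : Fin 7}
    (hl : Function.Bijective ![a, b, d, e, x, y, z])
    (hrel : ∀ q : QuadraticForm ℝ (Fin 3 → ℝ), ∑ k, c k * q (v k) = 0) :
    c x * (bracket ε (v a) (v b) (v x) * bracket ε (v d) (v e) (v x)) +
      c y * (bracket ε (v a) (v b) (v y) * bracket ε (v d) (v e) (v y)) +
      c z * (bracket ε (v a) (v b) (v z) * bracket ε (v d) (v e) (v z)) = 0 := by
  have h := hrel (QuadraticMap.linMulLin (bracket ε (v a) (v b)) (bracket ε (v d) (v e)))
  rw [← hl.sum_comp] at h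
  simpa [Fin.sum_univ_seven] using h

theorem mul_neg_of_lines {a b d e x y z : Fin 7} (hv : PositiveFrame f ε v)
    (hrel : ∀ q : QuadraticForm ℝ (Fin 3 → ℝ), ∑ k, c k * q (v k) = 0)
    (hl : Function.Bijective ![a, b, d, e, x, y, z])
    (hx : CyclicOrder a b x ∧ CyclicOrder d e x) (hy : CyclicOrder a b y ∧ CyclicOrder d e y)
    (hz : CyclicOrder a b z ∧ CyclicOrder d e z) (hc : 0 < c x * c y) : c x * c z < 0 := by
  have h := relation_of_lines (ε := ε) hl hrel
  have h4 := mul_pos (hv.pos _ _ _ hx.1) (hv.pos _ _ _ hx.2)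
  have h5 := mul_pos (hv.pos _ _ _ hy.1) (hv.pos _ _ _ hy.2)
  have h6 := mul_pos (hv.pos _ _ _ hz.1) (hv.pos _ _ _ hz.2)
  have h7 := mul_pos (sq_pos_of_ne_zero (left_ne_zero_of_mul hc.ne')) h4
  have h8 := mul_pos hc h5
  refine neg_of_mul_neg_left (b := bracket ε (v a) (v b) (v z) * bracket ε (v d) (v e) (v z))
    ?_ h6.le
  linear_combination c x * h + h7 + h8

theorem mul_pos_of_lines {a b d e x y z : Fin 7} (hv : PositiveFrame f ε v)
    (hrel : ∀ q : QuadraticForm ℝ (Fin 3 → ℝ), ∑ k, c k * q (v k) = 0)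
    (hl : Function.Bijective ![a, b, d, e, x, y, z])
    (hx : CyclicOrder a b x ∧ CyclicOrder d e x) (hy : CyclicOrder a b y ∧ CyclicOrder d e y)
    (hz : CyclicOrder a z b ∧ CyclicOrder d e z) (hc : 0 < c x * c y) : 0 < c x * c z := by
  have h := relation_of_lines (ε := ε) hl hrel
  have h4 := mul_pos (hv.pos _ _ _ hx.1) (hv.pos _ _ _ hx.2)
  have h5 := mul_pos (hv.pos _ _ _ hy.1) (hv.pos _ _ _ hy.2)
  have h6 := mul_pos (hv.pos _ _ _ hz.1) (hv.pos _ _ _ hz.2)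
  have h7 := mul_pos (sq_pos_of_ne_zero (left_ne_zero_of_mul hc.ne')) h4
  have h8 := mul_pos hc h5
  rw [bracket_swap_right ε (v a) (v z) (v b)] at h
  refine pos_of_mul_pos_left (b := bracket ε (v a) (v z) (v b) * bracket ε (v d) (v e) (v z))
    ?_ h6.le
  linear_combination c x * h + h7 + h8

theorem dIdx_congr {g : Fin 7 → RP2} {a b : Fin 7} (h : OutAll f i j ↔ OutAll g a b) :
    dIdx f i j = dIdx g a b := by
  by_cases hg : OutAll g a b
  · simp [dIdx, hg, h.2 hg]
  · simp [dIdx, hg, mt h.1 hg]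

theorem dIdx_eq_zero_or_one (f : Fin 7 → RP2) (i j : Fin 7) : dIdx f i j = 0 ∨ dIdx f i j = 1 := by
  by_cases h : OutAll f i j <;> simp [dIdx, h]

theorem domIdx_zero_eq : domIdx f 0 =
    dIdx f 0 1 + dIdx f 0 2 + dIdx f 0 3 + dIdx f 0 4 + dIdx f 0 5 + dIdx f 0 6 := by
  have : (Finset.univ.erase 0 : Finset (Fin 7)) = {1, 2, 3, 4, 5, 6} := by decide
  rw [domIdx, this]
  simp [add_assoc]

theorem domIdx_zero_of_alternating (hf : TypicalCfg f) (hv : PositiveFrame f ε v)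
    (hrel : ∀ q : QuadraticForm ℝ (Fin 3 → ℝ), ∑ k, c k * q (v k) = 0) (hc0 : c 0 ≠ 0)
    (h12 : c 1 * c 2 < 0) (h23 : c 2 * c 3 < 0) (h34 : c 3 * c 4 < 0) (h45 : c 4 * c 5 < 0)
    (h56 : c 5 * c 6 < 0) : domIdx f 0 = 0 ∨ domIdx f 0 = 6 := by
  have e12 : dIdx f 0 1 = dIdx f 0 2 := dIdx_congr <|
    outAll_iff_outAll_of_neg (a := 3) (b := 4) (d := 5) (e := 6)
      ⟨by decide, by decide, by decide, by decide, by decide⟩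
      ⟨by decide, by decide, by decide, by decide, by decide⟩ hf hv hrel hc0 h12
  have e23 : dIdx f 0 2 = dIdx f 0 3 := dIdx_congr <|
    outAll_iff_outAll_of_neg (a := 4) (b := 5) (d := 6) (e := 1)
      ⟨by decide, by decide, by decide, by decide, by decide⟩
      ⟨by decide, by decide, by decide, by decide, by decide⟩ hf hv hrel hc0 h23
  have e34 : dIdx f 0 3 = dIdx f 0 4 := dIdx_congr <|
    outAll_iff_outAll_of_neg (a := 5) (b := 6) (d := 1) (e := 2)
      ⟨by decide, by decide, by decide, by decide, by decide⟩
      ⟨by decide, by decide, by decide, by decide, by decide⟩ hf hv hrel hc0 h34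
  have e45 : dIdx f 0 4 = dIdx f 0 5 := dIdx_congr <|
    outAll_iff_outAll_of_neg (a := 6) (b := 1) (d := 2) (e := 3)
      ⟨by decide, by decide, by decide, by decide, by decide⟩
      ⟨by decide, by decide, by decide, by decide, by decide⟩ hf hv hrel hc0 h45
  have e56 : dIdx f 0 5 = dIdx f 0 6 := dIdx_congr <|
    outAll_iff_outAll_of_neg (a := 1) (b := 2) (d := 3) (e := 4)
      ⟨by decide, by decide, by decide, by decide, by decide⟩
      ⟨by decide, by decide, by decide, by decide, by decide⟩ hf hv hrel hc0 h56
  rw [domIdx_zero_eq]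
  rcases dIdx_eq_zero_or_one f 0 6 with h | h <;> omega

theorem neg_of_mul_neg_of_mul_pos {x y z : ℝ} (hy : x * y < 0) (hz : 0 < x * z) : y * z < 0 := by
  have h := mul_neg_of_neg_of_pos hy hz
  refine neg_of_mul_neg_right (a := x ^ 2) ?_ (sq_nonneg x)
  linarith

theorem didx_symmetric_at_zero (hf : TypicalCfg f) (hconv : ConsecConvexPos f)
    (h0 : domIdx f 0 ≠ 0) (h6 : domIdx f 0 ≠ 6) :
    dIdx f 0 1 = dIdx f 1 0 ∧ dIdx f 0 6 = dIdx f 6 0 := by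
  obtain ⟨ε, v, hv⟩ := exists_positiveFrame hf.1 hconv
  obtain ⟨c, hc, hrel⟩ := exists_conic_relation (v := v) fun j q hq =>
    hf.eq_zero_of_map_rep_eq_zero j fun k hk => (hv.map_rep_eq_zero_iff q k).2 (hq k hk)
  have halt := domIdx_zero_of_alternating hf hv hrel (hc 0)
  have c01 : c 0 * c 1 < 0 := by
    refine (lt_or_gt_of_ne (mul_ne_zero (hc 0) (hc 1))).resolve_right fun h1 => ?_
    have h2 := mul_neg_of_lines hv hrel (show Function.Bijective ![3, 4, 5, 6, 0, 1, 2] by decide)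
      (by decide) (by decide) (by decide) h1
    have h3 := mul_pos_of_lines hv hrel (show Function.Bijective ![2, 4, 5, 6, 0, 1, 3] by decide)
      (by decide) (by decide) (by decide) h1
    have h4 := mul_neg_of_lines hv hrel (show Function.Bijective ![2, 3, 5, 6, 0, 1, 4] by decide)
      (by decide) (by decide) (by decide) h1
    have h5 := mul_pos_of_lines hv hrel (show Function.Bijective ![4, 6, 2, 3, 0, 1, 5] by decide)
      (by decide) (by decide) (by decide) h1
    have h6' := mul_neg_of_lines hv hrel (show Function.Bijective ![2, 3, 4, 5, 0, 1, 6] by decide)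
      (by decide) (by decide) (by decide) h1
    exact (halt (by rw [mul_comm]; exact neg_of_mul_neg_of_mul_pos h2 h1)
      (neg_of_mul_neg_of_mul_pos h2 h3)
      (by rw [mul_comm]; exact neg_of_mul_neg_of_mul_pos h4 h3)
      (neg_of_mul_neg_of_mul_pos h4 h5)
      (by rw [mul_comm]; exact neg_of_mul_neg_of_mul_pos h6' h5)).elim h0 h6
  have c06 : c 0 * c 6 < 0 := by
    refine (lt_or_gt_of_ne (mul_ne_zero (hc 0) (hc 6))).resolve_right fun h6' => ?_
    have h1 := mul_neg_of_lines hv hrel (show Function.Bijective ![2, 3, 4, 5, 0, 6, 1] by decide)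
      (by decide) (by decide) (by decide) h6'
    have h2 := mul_pos_of_lines hv hrel (show Function.Bijective ![1, 3, 4, 5, 0, 6, 2] by decide)
      (by decide) (by decide) (by decide) h6'
    have h3 := mul_neg_of_lines hv hrel (show Function.Bijective ![1, 2, 4, 5, 0, 6, 3] by decide)
      (by decide) (by decide) (by decide) h6'
    have h4 := mul_pos_of_lines hv hrel (show Function.Bijective ![3, 5, 1, 2, 0, 6, 4] by decide)
      (by decide) (by decide) (by decide) h6'
    have h5 := mul_neg_of_lines hv hrel (show Function.Bijective ![1, 2, 3, 4, 0, 6, 5] by decide)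
      (by decide) (by decide) (by decide) h6'
    exact (halt (neg_of_mul_neg_of_mul_pos h1 h2)
      (by rw [mul_comm]; exact neg_of_mul_neg_of_mul_pos h3 h2)
      (neg_of_mul_neg_of_mul_pos h3 h4)
      (by rw [mul_comm]; exact neg_of_mul_neg_of_mul_pos h5 h4)
      (neg_of_mul_neg_of_mul_pos h5 h6')).elim h0 h6
  have e01 : OutAll f 0 1 ↔ OutAll f 1 0 :=
    IsPentagon.outAll_comm (l := ![2, 3, 4, 5, 6])
      ⟨by decide, by decide, by decide, by decide, by decide⟩ hf hv hrel c01
  have e06 : OutAll f 0 6 ↔ OutAll f 6 0 :=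
    IsPentagon.outAll_comm (l := ![1, 2, 3, 4, 5])
      ⟨by decide, by decide, by decide, by decide, by decide⟩ hf hv hrel c06
  exact ⟨dIdx_congr e01, dIdx_congr e06⟩

end DominanceIndex

section Rotation

variable {f : Fin 7 → RP2}

theorem TypicalCfg.rotate (hf : TypicalCfg f) (i : Fin 7) : TypicalCfg fun k => f (i + k) := by
  refine ⟨⟨hf.1.1.comp (add_right_injective i), fun a b c hab hac hbc => ?_⟩, fun g hg => ?_⟩
  · exact hf.1.2 _ _ _ (by simpa using hab) (by simpa using hac) (by simpa using hbc)
  · exact hf.2 (fun k => i + g k) ((add_right_injective i).comp hg)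

theorem ConsecConvexPos.rotate (hf : ConsecConvexPos f) (i : Fin 7) :
    ConsecConvexPos fun k => f (i + k) := by
  obtain ⟨φ, ⟨hφ, hrep, hhull⟩, hψ⟩ := hf
  refine ⟨φ, ⟨hφ, fun k => hrep _, fun k => ?_⟩, fun k => ?_⟩
  · have : (fun k => f (i + k)) '' {j | j ≠ k} = f '' {j | j ≠ i + k} := by
      ext p
      constructor
      · rintro ⟨j, hj, rfl⟩
        exact ⟨i + j, by simpa using hj, rfl⟩
      · rintro ⟨j, hj, rfl⟩
        exact ⟨j - i, fun h => hj (by rw [← h]; abel), by simp⟩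
    rw [this]
    exact hhull (i + k)
  · obtain ⟨ψ, h1, h2⟩ := hψ (i + k)
    refine ⟨ψ, by simpa only [add_assoc] using h1, fun j hj hj' => h2 (i + j) (by simpa using hj) ?_⟩
    rw [add_assoc]
    simpa using hj'

theorem outAll_rotate (i a b : Fin 7) :
    OutAll (fun k => f (i + k)) a b ↔ OutAll f (i + a) (i + b) := by
  refine forall₂_congr fun q _ => imp_congr ?_ Iff.rfl
  rw [← (Equiv.addLeft i).forall_congr_right
    (q := fun k => k ≠ i + a → k ≠ i + b → q (f k).rep = 0)]
  simp

theorem dIdx_rotate (i a b : Fin 7) :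
    dIdx (fun k => f (i + k)) a b = dIdx f (i + a) (i + b) :=
  dIdx_congr (outAll_rotate i a b)

theorem domIdx_rotate (i a : Fin 7) : domIdx (fun k => f (i + k)) a = domIdx f (i + a) := by
  simp only [domIdx, dIdx_rotate]
  refine Finset.sum_bij (fun j _ => i + j) ?_ ?_ ?_ ?_
  · intro j hj; simpa using hj
  · intro j _ k _ h; simpa using h
  · intro j hj
    exact ⟨j - i, by simpa [sub_eq_iff_eq_add'] using hj, by simp⟩
  · intro j _; rfl

end Rotation

/-- For a heptagonal typical 7-configuration numbered consecutively along the convex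
position, if `d(p_i) ∉ {0, 6}` then `d_{i,i+1} = d_{i+1,i}` and `d_{i,i-1} = d_{i-1,i}`. -/
theorem didx_symmetric_at_edges (f : Fin 7 → RP2)
    (hf : TypicalCfg f) (hconv : ConsecConvexPos f)
    (i : Fin 7) (h0 : domIdx f i ≠ 0) (h6 : domIdx f i ≠ 6) :
    dIdx f i (i + 1) = dIdx f (i + 1) i ∧ dIdx f i (i - 1) = dIdx f (i - 1) i := by
  have h := didx_symmetric_at_zero (hf.rotate i) (hconv.rotate i)
    (by rwa [domIdx_rotate, add_zero]) (by rwa [domIdx_rotate, add_zero])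
  have h6' : i + 6 = i - 1 := by
    clear * -; revert i; decide
  simpa only [dIdx_rotate, add_zero, h6'] using h

end
end
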